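/- arXiv:math/0211268 — 2 statements merged into one kernel-verified Lean document; each statement's English description precedes it below -/
import Mathlib

section
/- Let S be an admissible shape of P_{m,n} and let S' be an admissible subshape of S. Then the set of removed triangles is uniquely determined: if F₁, F₂ ⊆ T_max(S) are both sets of triangles with pairwise disjoint interiors, with interiors disjoint from S', and satisfying S = S' ∪ ⋃F₁ = S' ∪ ⋃F₂, then F₁ = F₂. -/
open Set

noncomputable section

/-- A point of the integer lattice `ℤ² ⊆ ℝ²`. -/
def IsLatticePoint (p : ℝ × ℝ) : Prop := ∃ a b : ℤ, p = ((a : ℝ), (b : ℝ))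

/-- A triangle: the convex hull of three affinely independent points of `ℝ²`. -/
def IsTriangle (Δ : Set (ℝ × ℝ)) : Prop :=
  ∃ p q r : ℝ × ℝ, AffineIndependent ℝ ![p, q, r] ∧ Δ = convexHull ℝ {p, q, r}

/-- `F` is a face of the triangle `Δ`: the empty set, a vertex, an edge,
or the whole triangle. -/
def IsFaceOf (F Δ : Set (ℝ × ℝ)) : Prop :=
  ∃ p q r : ℝ × ℝ, AffineIndependent ℝ ![p, q, r] ∧ Δ = convexHull ℝ {p, q, r} ∧
    (F = ∅ ∨ F = {p} ∨ F = {q} ∨ F = {r} ∨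
     F = segment ℝ p q ∨ F = segment ℝ q r ∨ F = segment ℝ p r ∨ F = Δ)

/-- The determinant of the two edge vectors of the triangle `pqr` emanating
from `p`; its absolute value is twice the Euclidean area of the triangle. -/
def triDet (p q r : ℝ × ℝ) : ℝ :=
  (q.1 - p.1) * (r.2 - p.2) - (q.2 - p.2) * (r.1 - p.1)

/-- A unimodular triangle: a lattice triangle of area `1/2`. -/
def IsUnimodularTriangle (Δ : Set (ℝ × ℝ)) : Prop :=
  ∃ p q r : ℝ × ℝ, IsLatticePoint p ∧ IsLatticePoint q ∧ IsLatticePoint r ∧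
    AffineIndependent ℝ ![p, q, r] ∧ Δ = convexHull ℝ {p, q, r} ∧
    |triDet p q r| = 1

/-- `T` is a unimodular triangulation of the region `P`. -/
def IsUnimodularTriangulation (P : Set (ℝ × ℝ)) (T : Set (Set (ℝ × ℝ))) : Prop :=
  T.Finite ∧ (∀ Δ ∈ T, IsUnimodularTriangle Δ ∧ Δ ⊆ P) ∧ ⋃₀ T = P ∧
  ∀ Δ₁ ∈ T, ∀ Δ₂ ∈ T, IsFaceOf (Δ₁ ∩ Δ₂) Δ₁ ∧ IsFaceOf (Δ₁ ∩ Δ₂) Δ₂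

/-- The number of unimodular triangulations of the region `P`. -/
def numTriangulations (P : Set (ℝ × ℝ)) : ℕ :=
  Set.ncard {T | IsUnimodularTriangulation P T}

/-- `f m n` is the number of unimodular triangulations of `[0,m] × [0,n]`. -/
def f (m n : ℕ) : ℕ :=
  numTriangulations (Set.Icc (0, 0) ((m : ℝ), (n : ℝ)))

/-- `Δ₂` lies above `Δ₁` (written `Δ₁ ≺ Δ₂`). -/
def LiesAbove (Δ₁ Δ₂ : Set (ℝ × ℝ)) : Prop :=
  ∃ x y₁ y₂ : ℝ, (x, y₁) ∈ Δ₁ \ Δ₂ ∧ (x, y₂) ∈ Δ₂ \ Δ₁ ∧ y₁ < y₂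

/-- `Δ` is a `≺`-maximal triangle of the set of triangles `T`. -/
def MaximalIn (Δ : Set (ℝ × ℝ)) (T : Set (Set (ℝ × ℝ))) : Prop :=
  Δ ∈ T ∧ ∀ Δ' ∈ T, ¬ LiesAbove Δ Δ'

/-- An admissible sequence `T 1, …, T (2mn)` for `P_{m,n}`: `T 1` is a unimodular
triangulation of `[0,m] × [0,n]` and each subsequent set arises by removing a
`≺`-maximal triangle. -/
def IsAdmissibleSeq (m n : ℕ) (T : ℕ → Set (Set (ℝ × ℝ))) : Prop :=
  IsUnimodularTriangulation (Set.Icc (0, 0) ((m : ℝ), (n : ℝ))) (T 1) ∧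
  ∀ i, 2 ≤ i → i ≤ 2 * m * n →
    ∃ Δ, MaximalIn Δ (T (i - 1)) ∧ T i = T (i - 1) \ {Δ}

/-- An admissible shape of `P_{m,n}`: the union of the triangles of some member
of an admissible sequence. -/
def IsAdmissibleShape (m n : ℕ) (S : Set (ℝ × ℝ)) : Prop :=
  ∃ (T : ℕ → Set (Set (ℝ × ℝ))) (i : ℕ),
    IsAdmissibleSeq m n T ∧ 1 ≤ i ∧ i ≤ 2 * m * n ∧ S = ⋃₀ (T i)

/-- `Tmax S`: the set of all unimodular triangles contained in `S` that are
`≺`-maximal in some unimodular triangulation of `S`. -/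
def Tmax (S : Set (ℝ × ℝ)) : Set (Set (ℝ × ℝ)) :=
  {Δ | IsUnimodularTriangle Δ ∧ Δ ⊆ S ∧
    ∃ T, IsUnimodularTriangulation S T ∧ MaximalIn Δ T}

/-- `F` is a valid set of removed triangles turning `S` into the subshape `S'`:
`F ⊆ Tmax S`, the triangles of `F` have pairwise disjoint interiors, their
interiors are disjoint from `S'`, and `S = S' ∪ ⋃F`. -/
def IsRemovedSet (S' S : Set (ℝ × ℝ)) (F : Set (Set (ℝ × ℝ))) : Prop :=
  F ⊆ Tmax S ∧
  (∀ Δ₁ ∈ F, ∀ Δ₂ ∈ F, Δ₁ ≠ Δ₂ → interior Δ₁ ∩ interior Δ₂ = ∅) ∧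
  (∀ Δ ∈ F, interior Δ ∩ S' = ∅) ∧
  S = S' ∪ ⋃₀ F

/-- `S'` is an admissible subshape of `S`. -/
def IsAdmissibleSubshape (m n : ℕ) (S' S : Set (ℝ × ℝ)) : Prop :=
  IsAdmissibleShape m n S' ∧ ∃ F, IsRemovedSet S' S F

/-- `#(S',S)`: the number of triangles removed from `S` to obtain the admissible
subshape `S'` (well defined by the uniqueness of the removed set). -/
def removedCount (S' S : Set (ℝ × ℝ)) : ℕ :=
  sInf {k | ∃ F, IsRemovedSet S' S F ∧ F.ncard = k}

theorem mem_convexHull_triple_iff {p q r z : ℝ × ℝ} :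
    z ∈ convexHull ℝ {p, q, r} ↔ ∃ a b c : ℝ, 0 ≤ a ∧ 0 ≤ b ∧ 0 ≤ c ∧ a + b + c = 1 ∧
      z = a • p + b • q + c • r := by
  constructor
  · intro h
    refine convexHull_min (t := {z | ∃ a b c : ℝ, 0 ≤ a ∧ 0 ≤ b ∧ 0 ≤ c ∧ a + b + c = 1 ∧
      z = a • p + b • q + c • r}) ?_ ?_ h
    · rintro w (rfl | rfl | rfl)
      · exact ⟨1, 0, 0, by simp⟩
      · exact ⟨0, 1, 0, by simp⟩
      · exact ⟨0, 0, 1, by simp⟩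
    · rintro _ ⟨a, b, c, ha, hb, hc, hs, rfl⟩ _ ⟨a', b', c', ha', hb', hc', hs', rfl⟩ s t hs0 ht0 hst
      refine ⟨s * a + t * a', s * b + t * b', s * c + t * c', by positivity, by positivity,
        by positivity, ?_, ?_⟩
      · linear_combination s * hs + t * hs' + hst
      · module
  · rintro ⟨a, b, c, ha, hb, hc, hs, rfl⟩
    have hconv := convex_convexHull ℝ ({p, q, r} : Set (ℝ × ℝ))
    have h := hconv.sum_mem (t := Finset.univ) (w := ![a, b, c]) (z := ![p, q, r])
      (by intro i _; fin_cases i <;> simpa) (by simp [Fin.sum_univ_three, hs])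
      (by intro i _; apply subset_convexHull; fin_cases i <;> simp)
    simpa [Fin.sum_univ_three] using h

theorem triDet_ne_zero {p q r : ℝ × ℝ} (h : AffineIndependent ℝ ![p, q, r]) :
    triDet p q r ≠ 0 := by
  intro h0
  rw [affineIndependent_iff_not_collinear_set] at h
  apply h
  rw [collinear_iff_of_mem (p₀ := p) (by simp)]
  unfold triDet at h0
  by_cases hpq : q = p
  · refine ⟨r - p, ?_⟩
    rintro w (rfl | rfl | rfl)
    · exact ⟨0, by simp⟩
    · exact ⟨0, by simp [hpq]⟩
    · exact ⟨1, by simp⟩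
  · refine ⟨q - p, ?_⟩
    rintro w (rfl | rfl | rfl)
    · exact ⟨0, by simp⟩
    · exact ⟨1, by simp⟩
    · by_cases h1 : q.1 - p.1 = 0
      · have h2 : q.2 - p.2 ≠ 0 := fun h2 =>
          hpq (Prod.ext (sub_eq_zero.1 h1) (sub_eq_zero.1 h2))
        refine ⟨(w.2 - p.2) / (q.2 - p.2), Prod.ext ?_ ?_⟩
        · have : w.1 - p.1 = 0 := by
            rw [h1] at h0
            simpa [h2] using h0
          simp [h1]
          linarith
        · simp
          field_simp
          ring
      · refine ⟨(w.1 - p.1) / (q.1 - p.1), Prod.ext ?_ ?_⟩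
        · simp
          field_simp
          ring
        · simp
          field_simp
          linarith

theorem notMem_segment_of_mem_interior {p q r z : ℝ × ℝ}
    (h : AffineIndependent ℝ ![p, q, r]) (hz : z ∈ interior (convexHull ℝ {p, q, r})) :
    z ∉ segment ℝ p q := by
  intro hs
  have hD := triDet_ne_zero h
  have hc : Filter.Tendsto (fun ε : ℝ => z - ε • (r - p)) (nhds 0) (nhds z) := by
    have : Continuous fun ε : ℝ => z - ε • (r - p) := by fun_prop
    simpa using this.tendsto 0
  have hev := (hc.eventually (mem_interior_iff_mem_nhds.1 hz)).filter_mono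
    (nhdsWithin_le_nhds (s := Ioi 0))
  obtain ⟨ε, hmem, hε⟩ := (hev.and self_mem_nhdsWithin).exists
  obtain ⟨a, b, c, -, -, hc0, hsum, heq⟩ := mem_convexHull_triple_iff.1 hmem
  obtain ⟨s, t, -, -, hst, rfl⟩ := hs
  have e1 := congrArg Prod.fst heq
  have e2 := congrArg Prod.snd heq
  simp only [Prod.fst_add, Prod.fst_sub, Prod.smul_fst, Prod.snd_add, Prod.snd_sub,
    Prod.smul_snd, smul_eq_mul] at e1 e2
  have key : (c + ε) * triDet p q r = 0 := by
    obtain rfl : a = 1 - b - c := by linarith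
    obtain rfl : s = 1 - t := by linarith
    unfold triDet
    linear_combination (q.2 - p.2) * e1 - (q.1 - p.1) * e2
  have hε' : (0 : ℝ) < ε := hε
  exact (mul_ne_zero (by positivity) hD) key

theorem IsFaceOf.eq_of_mem_interior {F Δ : Set (ℝ × ℝ)} {z : ℝ × ℝ} (h : IsFaceOf F Δ)
    (hz : z ∈ interior Δ) (hzF : z ∈ F) : F = Δ := by
  obtain ⟨p, q, r, hi, rfl, h⟩ := h
  have hpq := notMem_segment_of_mem_interior hi hz
  have hqr : z ∉ segment ℝ q r := by
    refine notMem_segment_of_mem_interior (r := p) ?_ ?_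
    · rw [affineIndependent_iff_not_collinear_set] at hi ⊢
      rwa [show ({q, r, p} : Set (ℝ × ℝ)) = {p, q, r} by ext; simp; tauto]
    · rwa [show ({q, r, p} : Set (ℝ × ℝ)) = {p, q, r} by ext; simp; tauto]
  have hpr : z ∉ segment ℝ p r := by
    refine notMem_segment_of_mem_interior (r := q) ?_ ?_
    · rw [affineIndependent_iff_not_collinear_set] at hi ⊢
      rwa [show ({p, r, q} : Set (ℝ × ℝ)) = {p, q, r} by ext; simp; tauto]
    · rwa [show ({p, r, q} : Set (ℝ × ℝ)) = {p, q, r} by ext; simp; tauto]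
  rcases h with rfl | rfl | rfl | rfl | rfl | rfl | rfl | rfl
  · exact hzF.elim
  · exact (hpq (by rw [mem_singleton_iff.1 hzF]; exact left_mem_segment ℝ _ _)).elim
  · exact (hpq (by rw [mem_singleton_iff.1 hzF]; exact right_mem_segment ℝ _ _)).elim
  · exact (hqr (by rw [mem_singleton_iff.1 hzF]; exact right_mem_segment ℝ _ _)).elim
  · exact (hpq hzF).elim
  · exact (hqr hzF).elim
  · exact (hpr hzF).elim
  · rfl

/-- The value at `(x, y)` of the affine function with integer coefficients `a`, `b`, `c`. -/
def affineForm (a b c : ℤ) (x y : ℝ) : ℝ := a * x + b * y + c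

/-- Over the open strip `k < x < k + 1` the triangle `Δ` is cut out by a lower bound on `y`
(nonnegativity of the form `a, b, c`) and an upper bound on `y` (nonnegativity of the form
`a', b', c'`), and these two forms determine all of `Δ`. -/
structure StripForm (Δ : Set (ℝ × ℝ)) (k : ℤ) where
  a : ℤ
  b : ℤ
  c : ℤ
  a' : ℤ
  b' : ℤ
  c' : ℤ
  b_pos : 0 < b
  b'_neg : b' < 0
  coprime : IsCoprime a b
  coprime' : IsCoprime a' b'
  mem_iff : ∀ x y : ℝ, (x, y) ∈ Δ ↔ 0 ≤ affineForm a b c x y ∧ 0 ≤ affineForm a' b' c' x y ∧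
    affineForm a b c x y + affineForm a' b' c' x y ≤ 1
  add_lt : ∀ x y : ℝ, (k : ℝ) < x → x < k + 1 → 0 ≤ affineForm a b c x y →
    0 ≤ affineForm a' b' c' x y → affineForm a b c x y + affineForm a' b' c' x y < 1
  exists_pos : ∀ x : ℝ, (k : ℝ) < x → x < k + 1 →
    ∃ y, 0 < affineForm a b c x y ∧ 0 < affineForm a' b' c' x y

namespace StripForm

variable {Δ : Set (ℝ × ℝ)} {k : ℤ}

theorem mem_of_nonneg (s : StripForm Δ k) {x y : ℝ} (h₁ : (k : ℝ) < x) (h₂ : x < k + 1)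
    (h : 0 ≤ affineForm s.a s.b s.c x y) (h' : 0 ≤ affineForm s.a' s.b' s.c' x y) :
    (x, y) ∈ Δ :=
  (s.mem_iff x y).2 ⟨h, h', (s.add_lt x y h₁ h₂ h h').le⟩

theorem mem_interior (s : StripForm Δ k) {x y : ℝ} (h₁ : (k : ℝ) < x) (h₂ : x < k + 1)
    (h : 0 < affineForm s.a s.b s.c x y) (h' : 0 < affineForm s.a' s.b' s.c' x y) :
    (x, y) ∈ interior Δ := by
  refine _root_.mem_interior.2 ⟨{z | (k : ℝ) < z.1 ∧ z.1 < k + 1 ∧ 0 < affineForm s.a s.b s.c z.1 z.2 ∧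
    0 < affineForm s.a' s.b' s.c' z.1 z.2}, ?_, ?_, ⟨h₁, h₂, h, h'⟩⟩
  · rintro ⟨u, v⟩ ⟨hu₁, hu₂, hv, hv'⟩
    exact s.mem_of_nonneg hu₁ hu₂ hv.le hv'.le
  · unfold affineForm
    refine IsOpen.and ?_ (IsOpen.and ?_ (IsOpen.and ?_ ?_)) <;>
      exact isOpen_lt (by fun_prop) (by fun_prop)

/-- The height of the lower boundary. -/
def bot (s : StripForm Δ k) (x : ℝ) : ℝ := -(s.a * x + s.c) / s.b

/-- The height of the upper boundary. -/
def top (s : StripForm Δ k) (x : ℝ) : ℝ := -(s.a' * x + s.c') / s.b'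

theorem affineForm_eq (s : StripForm Δ k) (x y : ℝ) :
    affineForm s.a s.b s.c x y = s.b * (y - s.bot x) := by
  have : (s.b : ℝ) ≠ 0 := by exact_mod_cast s.b_pos.ne'
  unfold affineForm bot
  field_simp
  ring

theorem affineForm'_eq (s : StripForm Δ k) (x y : ℝ) :
    affineForm s.a' s.b' s.c' x y = -s.b' * (s.top x - y) := by
  have : (s.b' : ℝ) ≠ 0 := by exact_mod_cast s.b'_neg.ne
  unfold affineForm top
  field_simp
  ring

theorem affineForm_nonneg_iff (s : StripForm Δ k) (x y : ℝ) :
    0 ≤ affineForm s.a s.b s.c x y ↔ s.bot x ≤ y := by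
  have : (0 : ℝ) < s.b := by exact_mod_cast s.b_pos
  rw [affineForm_eq, mul_nonneg_iff_of_pos_left this, sub_nonneg]

theorem affineForm_pos_iff (s : StripForm Δ k) (x y : ℝ) :
    0 < affineForm s.a s.b s.c x y ↔ s.bot x < y := by
  have : (0 : ℝ) < s.b := by exact_mod_cast s.b_pos
  rw [affineForm_eq, mul_pos_iff_of_pos_left this, sub_pos]

theorem affineForm'_nonneg_iff (s : StripForm Δ k) (x y : ℝ) :
    0 ≤ affineForm s.a' s.b' s.c' x y ↔ y ≤ s.top x := by
  have : (0 : ℝ) < -s.b' := by exact_mod_cast neg_pos.2 s.b'_neg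
  rw [affineForm'_eq, mul_nonneg_iff_of_pos_left this, sub_nonneg]

theorem affineForm'_pos_iff (s : StripForm Δ k) (x y : ℝ) :
    0 < affineForm s.a' s.b' s.c' x y ↔ y < s.top x := by
  have : (0 : ℝ) < -s.b' := by exact_mod_cast neg_pos.2 s.b'_neg
  rw [affineForm'_eq, mul_pos_iff_of_pos_left this, sub_pos]

theorem mem_strip_iff (s : StripForm Δ k) {x y : ℝ} (h₁ : (k : ℝ) < x) (h₂ : x < k + 1) :
    (x, y) ∈ Δ ↔ s.bot x ≤ y ∧ y ≤ s.top x := by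
  rw [← s.affineForm_nonneg_iff, ← s.affineForm'_nonneg_iff]
  exact ⟨fun h => ⟨((s.mem_iff x y).1 h).1, ((s.mem_iff x y).1 h).2.1⟩,
    fun h => s.mem_of_nonneg h₁ h₂ h.1 h.2⟩

theorem mem_interior_strip (s : StripForm Δ k) {x y : ℝ} (h₁ : (k : ℝ) < x) (h₂ : x < k + 1)
    (h : s.bot x < y) (h' : y < s.top x) : (x, y) ∈ interior Δ :=
  s.mem_interior h₁ h₂ ((s.affineForm_pos_iff x y).2 h) ((s.affineForm'_pos_iff x y).2 h')

theorem bot_lt_top (s : StripForm Δ k) {x : ℝ} (h₁ : (k : ℝ) < x) (h₂ : x < k + 1) :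
    s.bot x < s.top x := by
  obtain ⟨y, h, h'⟩ := s.exists_pos x h₁ h₂
  exact ((s.affineForm_pos_iff x y).1 h).trans ((s.affineForm'_pos_iff x y).1 h')

end StripForm

theorem coeff_eq_of_isCoprime {a b c a' b' c' : ℤ} (h : IsCoprime a b) (h' : IsCoprime a' b')
    (hbb : 0 < b * b') {u v : ℝ} (huv : u ≠ v)
    (hu : -(a * u + c) / b = -(a' * u + c') / (b' : ℝ))
    (hv : -(a * v + c) / b = -(a' * v + c') / (b' : ℝ)) : a = a' ∧ b = b' ∧ c = c' := by
  have hb : b ≠ 0 := by rintro rfl; simp at hbb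
  have hb' : b' ≠ 0 := by rintro rfl; simp at hbb
  have hbr : (b : ℝ) ≠ 0 := by exact_mod_cast hb
  have hbr' : (b' : ℝ) ≠ 0 := by exact_mod_cast hb'
  rw [div_eq_div_iff hbr hbr'] at hu hv
  have ha : (a : ℝ) * b' = a' * b :=
    mul_right_cancel₀ (sub_ne_zero.2 huv) (by linear_combination hv - hu)
  have hc : (c : ℝ) * b' = c' * b := by linear_combination -hu - u * ha
  have ha : a * b' = a' * b := by exact_mod_cast ha
  have hc : c * b' = c' * b := by exact_mod_cast hc
  have d₁ : b ∣ b' := h.symm.dvd_of_dvd_mul_left ⟨a', by rw [ha, mul_comm]⟩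
  have d₂ : b' ∣ b := h'.symm.dvd_of_dvd_mul_left ⟨a, by rw [← ha, mul_comm]⟩
  have hbeq : b = b' := by
    rcases Int.associated_iff.1 (associated_of_dvd_dvd d₁ d₂) with e | e
    · exact e
    · subst e
      nlinarith [mul_self_nonneg b']
  subst hbeq
  exact ⟨mul_right_cancel₀ hb ha, rfl, mul_right_cancel₀ hb hc⟩

theorem StripForm.eq_of_bot_eq_of_top_eq {Δ₁ Δ₂ : Set (ℝ × ℝ)} {k : ℤ} (s₁ : StripForm Δ₁ k)
    (s₂ : StripForm Δ₂ k) (hb : ∀ x : ℝ, (k : ℝ) < x → x < k + 1 → s₁.bot x = s₂.bot x)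
    (ht : ∀ x : ℝ, (k : ℝ) < x → x < k + 1 → s₁.top x = s₂.top x) : Δ₁ = Δ₂ := by
  have hu₁ : (k : ℝ) < k + 1 / 2 := by linarith
  have hu₂ : (k : ℝ) + 1 / 2 < k + 1 := by linarith
  have hv₁ : (k : ℝ) < k + 1 / 3 := by linarith
  have hv₂ : (k : ℝ) + 1 / 3 < k + 1 := by linarith
  have huv : (k : ℝ) + 1 / 2 ≠ k + 1 / 3 := by norm_num
  obtain ⟨e₁, e₂, e₃⟩ := coeff_eq_of_isCoprime s₁.coprime s₂.coprime
    (mul_pos s₁.b_pos s₂.b_pos) huv (hb _ hu₁ hu₂) (hb _ hv₁ hv₂)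
  obtain ⟨e₄, e₅, e₆⟩ := coeff_eq_of_isCoprime s₁.coprime' s₂.coprime'
    (mul_pos_of_neg_of_neg s₁.b'_neg s₂.b'_neg) huv (ht _ hu₁ hu₂) (ht _ hv₁ hv₂)
  ext ⟨x, y⟩
  rw [s₁.mem_iff, s₂.mem_iff, e₁, e₂, e₃, e₄, e₅, e₆]

theorem StripForm.nonempty_of_apex {k v₁ v₂ u₁ u₂ w₁ w₂ : ℤ}
    (h : ((u₁ - v₁) * (w₂ - v₂) - (u₂ - v₂) * (w₁ - v₁) = -1 ∧
        v₁ ≤ k ∧ k + 1 ≤ u₁ ∧ k + 1 ≤ w₁) ∨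
      ((u₁ - v₁) * (w₂ - v₂) - (u₂ - v₂) * (w₁ - v₁) = 1 ∧
        k + 1 ≤ v₁ ∧ u₁ ≤ k ∧ w₁ ≤ k)) :
    Nonempty (StripForm (convexHull ℝ {((v₁ : ℝ), (v₂ : ℝ)), ((u₁ : ℝ), (u₂ : ℝ)),
      ((w₁ : ℝ), (w₂ : ℝ))}) k) := by
  obtain ⟨D, hD⟩ : ∃ D, (u₁ - v₁) * (w₂ - v₂) - (u₂ - v₂) * (w₁ - v₁) = D := ⟨_, rfl⟩
  have hDD : D * D = 1 := by
    rcases h with h | h <;> rw [← hD, h.1] <;> norm_num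
  have hDr : ((u₁ : ℝ) - v₁) * (w₂ - v₂) - (u₂ - v₂) * (w₁ - v₁) = D := by exact_mod_cast hD
  have hDDr : (D : ℝ) * D = 1 := by exact_mod_cast hDD
  have hbeta : ∀ x y : ℝ, affineForm (D * (w₂ - v₂)) (-D * (w₁ - v₁))
      (D * (v₂ * (w₁ - v₁) - v₁ * (w₂ - v₂))) x y =
      D * ((x - v₁) * (w₂ - v₂) - (y - v₂) * (w₁ - v₁)) := by
    intro x y
    unfold affineForm
    push_cast
    ring
  have hgamma : ∀ x y : ℝ, affineForm (-D * (u₂ - v₂)) (D * (u₁ - v₁))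
      (D * (v₁ * (u₂ - v₂) - v₂ * (u₁ - v₁))) x y =
      D * ((u₁ - v₁) * (y - v₂) - (u₂ - v₂) * (x - v₁)) := by
    intro x y
    unfold affineForm
    push_cast
    ring
  have hx : ∀ x y : ℝ, x - v₁ =
      D * ((x - v₁) * (w₂ - v₂) - (y - v₂) * (w₁ - v₁)) * (u₁ - v₁) +
      D * ((u₁ - v₁) * (y - v₂) - (u₂ - v₂) * (x - v₁)) * (w₁ - v₁) := by
    intro x y
    linear_combination -(x - v₁) * hDDr - D * (x - v₁) * hDr
  have hy : ∀ x y : ℝ, y - v₂ =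
      D * ((x - v₁) * (w₂ - v₂) - (y - v₂) * (w₁ - v₁)) * (u₂ - v₂) +
      D * ((u₁ - v₁) * (y - v₂) - (u₂ - v₂) * (x - v₁)) * (w₂ - v₂) := by
    intro x y
    linear_combination -(y - v₂) * hDDr - D * (y - v₂) * hDr
  refine ⟨⟨D * (w₂ - v₂), -D * (w₁ - v₁), D * (v₂ * (w₁ - v₁) - v₁ * (w₂ - v₂)),
    -D * (u₂ - v₂), D * (u₁ - v₁), D * (v₁ * (u₂ - v₂) - v₂ * (u₁ - v₁)),
    ?_, ?_, ⟨u₁ - v₁, u₂ - v₂, ?_⟩, ⟨w₁ - v₁, w₂ - v₂, ?_⟩, ?_, ?_, ?_⟩⟩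
  · rcases h with ⟨h, h₁, h₂, h₃⟩ | ⟨h, h₁, h₂, h₃⟩ <;> rw [hD] at h <;> subst h <;> linarith
  · rcases h with ⟨h, h₁, h₂, h₃⟩ | ⟨h, h₁, h₂, h₃⟩ <;> rw [hD] at h <;> subst h <;> linarith
  · linear_combination D * hD + hDD
  · linear_combination D * hD + hDD
  · intro x y
    rw [hbeta, hgamma, mem_convexHull_triple_iff]
    constructor
    · rintro ⟨a, b, c, ha, hb, hc, hs, heq⟩
      obtain ⟨rfl, rfl⟩ := Prod.ext_iff.1 heq
      obtain rfl : a = 1 - b - c := by linarith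
      simp only [Prod.fst_add, Prod.smul_fst, Prod.snd_add, Prod.smul_snd, smul_eq_mul]
      have e₁ : D * (((1 - b - c) * v₁ + b * u₁ + c * w₁ - v₁) * (w₂ - v₂) -
          ((1 - b - c) * v₂ + b * u₂ + c * w₂ - v₂) * (w₁ - v₁)) = b := by
        linear_combination b * D * hDr + b * hDDr
      have e₂ : D * ((u₁ - v₁) * ((1 - b - c) * v₂ + b * u₂ + c * w₂ - v₂) -
          (u₂ - v₂) * ((1 - b - c) * v₁ + b * u₁ + c * w₁ - v₁)) = c := by
        linear_combination c * D * hDr + c * hDDr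
      rw [e₁, e₂]
      exact ⟨hb, hc, by linarith⟩
    · rintro ⟨hb, hc, hs⟩
      refine ⟨1 - (D * ((x - v₁) * (w₂ - v₂) - (y - v₂) * (w₁ - v₁))) -
        (D * ((u₁ - v₁) * (y - v₂) - (u₂ - v₂) * (x - v₁))), _, _, by linarith, hb, hc,
        by ring, Prod.ext ?_ ?_⟩
      · simp only [Prod.fst_add, Prod.smul_fst, smul_eq_mul]
        linear_combination hx x y
      · simp only [Prod.snd_add, Prod.smul_snd, smul_eq_mul]
        linear_combination hy x y
  · intro x y h₁ h₂
    rw [hbeta, hgamma]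
    intro hb hc
    have hxy := hx x y
    generalize (D : ℝ) * ((x - v₁) * (w₂ - v₂) - (y - v₂) * (w₁ - v₁)) = β at *
    generalize (D : ℝ) * ((u₁ - v₁) * (y - v₂) - (u₂ - v₂) * (x - v₁)) = γ at *
    rcases h with ⟨-, g₁, g₂, g₃⟩ | ⟨-, g₁, g₂, g₃⟩
    · have g₁ : (v₁ : ℝ) ≤ k := by exact_mod_cast g₁
      have g₂ : (k : ℝ) + 1 ≤ u₁ := by exact_mod_cast g₂
      have g₃ : (k : ℝ) + 1 ≤ w₁ := by exact_mod_cast g₃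
      by_contra! hcon
      nlinarith [mul_nonneg hb (sub_nonneg.2 g₂), mul_nonneg hc (sub_nonneg.2 g₃),
        mul_nonneg (sub_nonneg.2 hcon) (show (0 : ℝ) ≤ k + 1 - v₁ by linarith)]
    · have g₁ : (k : ℝ) + 1 ≤ v₁ := by exact_mod_cast g₁
      have g₂ : (u₁ : ℝ) ≤ k := by exact_mod_cast g₂
      have g₃ : (w₁ : ℝ) ≤ k := by exact_mod_cast g₃
      by_contra! hcon
      nlinarith [mul_nonneg hb (sub_nonneg.2 g₂), mul_nonneg hc (sub_nonneg.2 g₃),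
        mul_nonneg (sub_nonneg.2 hcon) (show (0 : ℝ) ≤ v₁ - k by linarith)]
  · intro x h₁ h₂
    have hden : 0 < (x - v₁) * ((u₁ : ℝ) + w₁ - 2 * v₁) ∧ (u₁ : ℝ) + w₁ - 2 * v₁ ≠ 0 := by
      rcases h with ⟨-, g₁, g₂, g₃⟩ | ⟨-, g₁, g₂, g₃⟩
      · have g₁ : (v₁ : ℝ) ≤ k := by exact_mod_cast g₁
        have g₂ : (k : ℝ) + 1 ≤ u₁ := by exact_mod_cast g₂
        have g₃ : (k : ℝ) + 1 ≤ w₁ := by exact_mod_cast g₃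
        have : (0 : ℝ) < u₁ + w₁ - 2 * v₁ := by linarith
        exact ⟨mul_pos (by linarith) this, this.ne'⟩
      · have g₁ : (k : ℝ) + 1 ≤ v₁ := by exact_mod_cast g₁
        have g₂ : (u₁ : ℝ) ≤ k := by exact_mod_cast g₂
        have g₃ : (w₁ : ℝ) ≤ k := by exact_mod_cast g₃
        have : (u₁ : ℝ) + w₁ - 2 * v₁ < 0 := by linarith
        exact ⟨mul_pos_of_neg_of_neg (by linarith) this, this.ne⟩
    obtain ⟨hpos, hne⟩ := hden
    obtain ⟨t, ht⟩ : ∃ t, t = (x - v₁) / ((u₁ : ℝ) + w₁ - 2 * v₁) := ⟨_, rfl⟩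
    have ht0 : 0 < t := by
      rw [ht]
      exact div_pos_iff.2 (mul_pos_iff.1 hpos)
    have htx : x = v₁ + t * (u₁ + w₁ - 2 * v₁) := by
      rw [ht, div_mul_cancel₀ _ hne]
      ring
    refine ⟨v₂ + t * (u₂ + w₂ - 2 * v₂), ?_, ?_⟩
    · rw [hbeta, htx]
      convert ht0 using 1
      linear_combination t * D * hDr + t * hDDr
    · rw [hgamma, htx]
      convert ht0 using 1
      linear_combination t * D * hDr + t * hDDr

theorem IsUnimodularTriangle.nonempty_stripForm {Δ : Set (ℝ × ℝ)} (h : IsUnimodularTriangle Δ)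
    {k : ℤ} {x y : ℝ} (h₁ : (k : ℝ) < x) (h₂ : x < k + 1) (hmem : (x, y) ∈ Δ) :
    Nonempty (StripForm Δ k) := by
  obtain ⟨_, _, _, ⟨p₁, p₂, rfl⟩, ⟨q₁, q₂, rfl⟩, ⟨r₁, r₂, rfl⟩, -, rfl, hD⟩ := h
  have hD : |(q₁ - p₁) * (r₂ - p₂) - (q₂ - p₂) * (r₁ - p₁)| = 1 := by
    simp only [triDet] at hD
    exact_mod_cast hD
  obtain ⟨a, b, c, ha, hb, hc, hs, heq⟩ := mem_convexHull_triple_iff.1 hmem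
  have hx : x = a * p₁ + b * q₁ + c * r₁ := by simpa using congrArg Prod.fst heq
  obtain rfl : a = 1 - b - c := by linarith
  have hlow : ¬ (p₁ ≤ k ∧ q₁ ≤ k ∧ r₁ ≤ k) := by
    rintro ⟨g₁, g₂, g₃⟩
    have g₁ : (p₁ : ℝ) ≤ k := by exact_mod_cast g₁
    have g₂ : (q₁ : ℝ) ≤ k := by exact_mod_cast g₂
    have g₃ : (r₁ : ℝ) ≤ k := by exact_mod_cast g₃
    nlinarith [mul_nonneg ha (sub_nonneg.2 g₁), mul_nonneg hb (sub_nonneg.2 g₂),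
      mul_nonneg hc (sub_nonneg.2 g₃)]
  have hhigh : ¬ (k + 1 ≤ p₁ ∧ k + 1 ≤ q₁ ∧ k + 1 ≤ r₁) := by
    rintro ⟨g₁, g₂, g₃⟩
    have g₁ : (k : ℝ) + 1 ≤ p₁ := by exact_mod_cast g₁
    have g₂ : (k : ℝ) + 1 ≤ q₁ := by exact_mod_cast g₂
    have g₃ : (k : ℝ) + 1 ≤ r₁ := by exact_mod_cast g₃
    nlinarith [mul_nonneg ha (sub_nonneg.2 g₁), mul_nonneg hb (sub_nonneg.2 g₂),
      mul_nonneg hc (sub_nonneg.2 g₃)]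
  have apex : ∀ v₁ v₂ u₁ u₂ w₁ w₂ : ℤ,
      |(u₁ - v₁) * (w₂ - v₂) - (u₂ - v₂) * (w₁ - v₁)| = 1 →
      (v₁ ≤ k ∧ k + 1 ≤ u₁ ∧ k + 1 ≤ w₁) ∨ (k + 1 ≤ v₁ ∧ u₁ ≤ k ∧ w₁ ≤ k) →
      Nonempty (StripForm (convexHull ℝ {((v₁ : ℝ), (v₂ : ℝ)), ((u₁ : ℝ), (u₂ : ℝ)),
        ((w₁ : ℝ), (w₂ : ℝ))}) k) := by
    intro v₁ v₂ u₁ u₂ w₁ w₂ hdet hside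
    rcases eq_or_eq_neg_of_abs_eq hdet with e | e <;> rcases hside with ⟨g₁, g₂, g₃⟩ | ⟨g₁, g₂, g₃⟩
    · rw [show ({((v₁ : ℝ), (v₂ : ℝ)), ((u₁ : ℝ), (u₂ : ℝ)), ((w₁ : ℝ), (w₂ : ℝ))} :
        Set (ℝ × ℝ)) = {((v₁ : ℝ), (v₂ : ℝ)), ((w₁ : ℝ), (w₂ : ℝ)), ((u₁ : ℝ), (u₂ : ℝ))} by
          rw [pair_comm ((u₁ : ℝ), (u₂ : ℝ))]]
      exact StripForm.nonempty_of_apex (Or.inl ⟨by linear_combination -e, g₁, g₃, g₂⟩)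
    · exact StripForm.nonempty_of_apex (Or.inr ⟨e, g₁, g₂, g₃⟩)
    · exact StripForm.nonempty_of_apex (Or.inl ⟨e, g₁, g₂, g₃⟩)
    · rw [show ({((v₁ : ℝ), (v₂ : ℝ)), ((u₁ : ℝ), (u₂ : ℝ)), ((w₁ : ℝ), (w₂ : ℝ))} :
        Set (ℝ × ℝ)) = {((v₁ : ℝ), (v₂ : ℝ)), ((w₁ : ℝ), (w₂ : ℝ)), ((u₁ : ℝ), (u₂ : ℝ))} by
          rw [pair_comm ((u₁ : ℝ), (u₂ : ℝ))]]
      exact StripForm.nonempty_of_apex (Or.inr ⟨by linear_combination -e, g₁, g₃, g₂⟩)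
  have hcases :
      ((p₁ ≤ k ∧ k + 1 ≤ q₁ ∧ k + 1 ≤ r₁) ∨ (k + 1 ≤ p₁ ∧ q₁ ≤ k ∧ r₁ ≤ k)) ∨
      ((q₁ ≤ k ∧ k + 1 ≤ r₁ ∧ k + 1 ≤ p₁) ∨ (k + 1 ≤ q₁ ∧ r₁ ≤ k ∧ p₁ ≤ k)) ∨
      ((r₁ ≤ k ∧ k + 1 ≤ p₁ ∧ k + 1 ≤ q₁) ∨ (k + 1 ≤ r₁ ∧ p₁ ≤ k ∧ q₁ ≤ k)) := by
    omega
  rcases hcases with hp | hq | hr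
  · exact apex _ _ _ _ _ _ hD hp
  · rw [show ({((p₁ : ℝ), (p₂ : ℝ)), ((q₁ : ℝ), (q₂ : ℝ)), ((r₁ : ℝ), (r₂ : ℝ))} :
        Set (ℝ × ℝ)) = {((q₁ : ℝ), (q₂ : ℝ)), ((r₁ : ℝ), (r₂ : ℝ)), ((p₁ : ℝ), (p₂ : ℝ))} by
          ext; simp only [mem_insert_iff, mem_singleton_iff]; tauto]
    refine apex _ _ _ _ _ _ ?_ hq
    rw [← hD]
    congr 1
    ring
  · rw [show ({((p₁ : ℝ), (p₂ : ℝ)), ((q₁ : ℝ), (q₂ : ℝ)), ((r₁ : ℝ), (r₂ : ℝ))} :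
        Set (ℝ × ℝ)) = {((r₁ : ℝ), (r₂ : ℝ)), ((p₁ : ℝ), (p₂ : ℝ)), ((q₁ : ℝ), (q₂ : ℝ))} by
          ext; simp only [mem_insert_iff, mem_singleton_iff]; tauto]
    refine apex _ _ _ _ _ _ ?_ hr
    rw [← hD]
    congr 1
    ring

theorem IsUnimodularTriangle.exists_mem_strip {Δ : Set (ℝ × ℝ)} (h : IsUnimodularTriangle Δ) :
    ∃ (k : ℤ) (y : ℝ), ((k : ℝ) + 1 / 2, y) ∈ Δ := by
  obtain ⟨_, _, _, ⟨p₁, p₂, rfl⟩, ⟨q₁, q₂, rfl⟩, ⟨r₁, r₂, rfl⟩, -, rfl, hD⟩ := h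
  have hseg : ∀ u₁ u₂ w₁ w₂ : ℤ, u₁ < w₁ → ∃ y : ℝ,
      ((u₁ : ℝ) + 1 / 2, y) ∈ segment ℝ ((u₁ : ℝ), (u₂ : ℝ)) ((w₁ : ℝ), (w₂ : ℝ)) := by
    intro u₁ u₂ w₁ w₂ huw
    have huw : (u₁ : ℝ) + 1 ≤ w₁ := by exact_mod_cast huw
    have hpos : (0 : ℝ) < 2 * (w₁ - u₁) := by linarith
    obtain ⟨t, ht⟩ : ∃ t : ℝ, t = 1 / (2 * (w₁ - u₁)) := ⟨_, rfl⟩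
    have ht0 : 0 ≤ t := by rw [ht]; positivity
    have ht1 : t ≤ 1 := by rw [ht, div_le_one hpos]; linarith
    have htm : t * (2 * (w₁ - u₁)) = 1 := by rw [ht, div_mul_cancel₀ _ hpos.ne']
    refine ⟨(1 - t) * u₂ + t * w₂, 1 - t, t, by linarith, ht0, by ring, Prod.ext ?_ ?_⟩
    · simp only [Prod.fst_add, Prod.smul_fst, smul_eq_mul]
      linear_combination htm / 2
    · simp
  have hsub : ∀ u ∈ ({((p₁ : ℝ), (p₂ : ℝ)), ((q₁ : ℝ), (q₂ : ℝ)), ((r₁ : ℝ), (r₂ : ℝ))} :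
      Set (ℝ × ℝ)), ∀ w ∈ ({((p₁ : ℝ), (p₂ : ℝ)), ((q₁ : ℝ), (q₂ : ℝ)), ((r₁ : ℝ), (r₂ : ℝ))} :
      Set (ℝ × ℝ)), segment ℝ u w ⊆ convexHull ℝ
        {((p₁ : ℝ), (p₂ : ℝ)), ((q₁ : ℝ), (q₂ : ℝ)), ((r₁ : ℝ), (r₂ : ℝ))} :=
    fun u hu w hw => (convex_convexHull ℝ _).segment_subset
      (subset_convexHull ℝ _ hu) (subset_convexHull ℝ _ hw)
  rcases lt_trichotomy p₁ q₁ with hpq | rfl | hpq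
  · obtain ⟨y, hy⟩ := hseg p₁ p₂ q₁ q₂ hpq
    exact ⟨p₁, y, hsub _ (by simp) _ (by simp) hy⟩
  · rcases lt_trichotomy p₁ r₁ with hpr | rfl | hpr
    · obtain ⟨y, hy⟩ := hseg p₁ p₂ r₁ r₂ hpr
      exact ⟨p₁, y, hsub _ (by simp) _ (by simp) hy⟩
    · simp [triDet] at hD
    · obtain ⟨y, hy⟩ := hseg r₁ r₂ p₁ p₂ hpr
      exact ⟨r₁, y, hsub _ (by simp) _ (by simp) hy⟩
  · obtain ⟨y, hy⟩ := hseg q₁ q₂ p₁ p₂ hpq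
    exact ⟨q₁, y, hsub _ (by simp) _ (by simp) hy⟩

/-- Nothing in `S` lies above a triangle of `Tmax S`. -/
theorem StripForm.le_top {S Δ : Set (ℝ × ℝ)} {k : ℤ} (s : StripForm Δ k) (hΔ : Δ ∈ Tmax S)
    {x y : ℝ} (h₁ : (k : ℝ) < x) (h₂ : x < k + 1) (hxy : (x, y) ∈ S) : y ≤ s.top x := by
  obtain ⟨-, -, T, ⟨-, -, hT, hface⟩, hΔT, hmax⟩ := hΔ
  rw [← hT] at hxy
  obtain ⟨Δ', hΔ', hxy⟩ := hxy
  by_contra! hlt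
  have hnot : (x, y) ∉ Δ := fun h => hlt.not_ge ((s.mem_strip_iff h₁ h₂).1 h).2
  obtain ⟨z, hz₁, hz₂⟩ := exists_between (s.bot_lt_top h₁ h₂)
  have hint := s.mem_interior_strip h₁ h₂ hz₁ hz₂
  have hzΔ := interior_subset hint
  have hzΔ' : (x, z) ∈ Δ' := by
    by_contra hz
    exact hmax Δ' hΔ' ⟨x, z, y, ⟨hzΔ, hz⟩, ⟨hxy, hnot⟩, hz₂.trans hlt⟩
  obtain ⟨f₁, f₂⟩ := hface Δ hΔT Δ' hΔ'
  have e₁ := f₁.eq_of_mem_interior hint ⟨hzΔ, hzΔ'⟩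
  have e₂ := f₂.eq_of_mem_interior (interior_mono (inter_eq_left.1 e₁) hint) ⟨hzΔ, hzΔ'⟩
  exact hnot (inter_eq_right.1 e₂ hxy)

theorem StripForm.top_le_top {S Δ₁ Δ₂ : Set (ℝ × ℝ)} {k : ℤ} (s₁ : StripForm Δ₁ k)
    (s₂ : StripForm Δ₂ k) (h₁ : Δ₁ ∈ Tmax S) (h₂ : Δ₂ ∈ Tmax S) {x : ℝ} (hx₁ : (k : ℝ) < x)
    (hx₂ : x < k + 1) : s₁.top x ≤ s₂.top x :=
  s₂.le_top h₂ hx₁ hx₂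
    (h₁.2.1 ((s₁.mem_strip_iff hx₁ hx₂).2 ⟨(s₁.bot_lt_top hx₁ hx₂).le, le_rfl⟩))

theorem IsRemovedSet.eq_of_stripForm {S' S Δ₁ Δ₂ : Set (ℝ × ℝ)} {F : Set (Set (ℝ × ℝ))}
    (hF : IsRemovedSet S' S F) (h₁ : Δ₁ ∈ F) (h₂ : Δ₂ ∈ F) {k : ℤ} (s₁ : StripForm Δ₁ k)
    (s₂ : StripForm Δ₂ k) : Δ₁ = Δ₂ := by
  by_contra hne
  have hx₁ : (k : ℝ) < k + 1 / 2 := by linarith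
  have hx₂ : (k : ℝ) + 1 / 2 < k + 1 := by linarith
  have l₁ := s₁.bot_lt_top hx₁ hx₂
  have l₂ := s₂.bot_lt_top hx₁ hx₂
  have htop : s₁.top _ = s₂.top _ := le_antisymm
    (s₁.top_le_top s₂ (hF.1 h₁) (hF.1 h₂) hx₁ hx₂) (s₂.top_le_top s₁ (hF.1 h₂) (hF.1 h₁) hx₁ hx₂)
  obtain ⟨y, hy, hy'⟩ := exists_between (max_lt l₁ (htop ▸ l₂))
  obtain ⟨g₁, g₂⟩ := max_lt_iff.1 hy
  have hmem : ((k : ℝ) + 1 / 2, y) ∈ interior Δ₁ ∩ interior Δ₂ :=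
    ⟨s₁.mem_interior_strip hx₁ hx₂ g₁ hy', s₂.mem_interior_strip hx₁ hx₂ g₂ (htop ▸ hy')⟩
  rw [hF.2.1 Δ₁ h₁ Δ₂ h₂ hne] at hmem
  exact hmem

theorem IsRemovedSet.exists_mem {S' S Δ : Set (ℝ × ℝ)} {F₁ F₂ : Set (Set (ℝ × ℝ))}
    (h₁ : IsRemovedSet S' S F₁) (h₂ : IsRemovedSet S' S F₂) (hΔ : Δ ∈ F₁) {z : ℝ × ℝ}
    (hz : z ∈ interior Δ) : ∃ Δ' ∈ F₂, z ∈ Δ' := by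
  have hS : z ∈ S := (h₁.1 hΔ).2.1 (interior_subset hz)
  rw [h₂.2.2.2] at hS
  refine hS.resolve_left fun hS' => ?_
  have hmem : z ∈ interior Δ ∩ S' := ⟨hz, hS'⟩
  rw [h₁.2.2.1 Δ hΔ] at hmem
  exact hmem

theorem IsRemovedSet.bot_le_bot {S' S Δ₁ Δ₂ : Set (ℝ × ℝ)} {F₁ F₂ : Set (Set (ℝ × ℝ))}
    (h₁ : IsRemovedSet S' S F₁) (h₂ : IsRemovedSet S' S F₂) (hΔ₁ : Δ₁ ∈ F₁) (hΔ₂ : Δ₂ ∈ F₂)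
    {k : ℤ} (s₁ : StripForm Δ₁ k) (s₂ : StripForm Δ₂ k) {x : ℝ} (hx₁ : (k : ℝ) < x)
    (hx₂ : x < k + 1) : s₂.bot x ≤ s₁.bot x := by
  by_contra! hlt
  obtain ⟨y, hy, hy'⟩ := exists_between (lt_min hlt (s₁.bot_lt_top hx₁ hx₂))
  obtain ⟨g₂, g₁⟩ := lt_min_iff.1 hy'
  obtain ⟨Δ₃, hΔ₃, hmem⟩ := h₁.exists_mem h₂ hΔ₁ (s₁.mem_interior_strip hx₁ hx₂ hy g₁)
  obtain ⟨s₃⟩ := (h₂.1 hΔ₃).1.nonempty_stripForm hx₁ hx₂ hmem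
  rw [h₂.eq_of_stripForm hΔ₃ hΔ₂ s₃ s₂, s₂.mem_strip_iff hx₁ hx₂] at hmem
  exact g₂.not_ge hmem.1

theorem IsRemovedSet.subset {S' S : Set (ℝ × ℝ)} {F₁ F₂ : Set (Set (ℝ × ℝ))}
    (h₁ : IsRemovedSet S' S F₁) (h₂ : IsRemovedSet S' S F₂) : F₁ ⊆ F₂ := by
  intro Δ₁ hΔ₁
  obtain ⟨k, y, hy⟩ := (h₁.1 hΔ₁).1.exists_mem_strip
  have hx₁ : (k : ℝ) < k + 1 / 2 := by linarith
  have hx₂ : (k : ℝ) + 1 / 2 < k + 1 := by linarith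
  obtain ⟨s₁⟩ := (h₁.1 hΔ₁).1.nonempty_stripForm hx₁ hx₂ hy
  obtain ⟨z, hz, hz'⟩ := exists_between (s₁.bot_lt_top hx₁ hx₂)
  obtain ⟨Δ₂, hΔ₂, hmem⟩ := h₁.exists_mem h₂ hΔ₁ (s₁.mem_interior_strip hx₁ hx₂ hz hz')
  obtain ⟨s₂⟩ := (h₂.1 hΔ₂).1.nonempty_stripForm hx₁ hx₂ hmem
  have heq : Δ₁ = Δ₂ := s₁.eq_of_bot_eq_of_top_eq s₂
    (fun x hx hx' => le_antisymm (h₂.bot_le_bot h₁ hΔ₂ hΔ₁ s₂ s₁ hx hx')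
      (h₁.bot_le_bot h₂ hΔ₁ hΔ₂ s₁ s₂ hx hx'))
    (fun x hx hx' => le_antisymm (s₁.top_le_top s₂ (h₁.1 hΔ₁) (h₂.1 hΔ₂) hx hx')
      (s₂.top_le_top s₁ (h₂.1 hΔ₂) (h₁.1 hΔ₁) hx hx'))
  rwa [heq]

/-- The set of triangles removed to obtain an admissible subshape is uniquely
determined. -/
theorem removedSet_unique (m n : ℕ) (hm : 1 ≤ m) (hn : 1 ≤ n)
    (S S' : Set (ℝ × ℝ)) (hS : IsAdmissibleShape m n S)
    (hsub : IsAdmissibleSubshape m n S' S)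
    (F₁ F₂ : Set (Set (ℝ × ℝ)))
    (h₁ : IsRemovedSet S' S F₁) (h₂ : IsRemovedSet S' S F₂) :
    F₁ = F₂ := by
  exact (h₁.subset h₂).antisymm (h₂.subset h₁)
end
end

section
/- For all integers m, n ≥ 1, the number of admissible shapes of P_{m,n} is at most (3n+2)^{m−1}·(n+1)². -/
open Set

noncomputable section

/-! ### Triangles -/

theorem mem_convexHull_triple {p q r z : ℝ × ℝ} :
    z ∈ convexHull ℝ {p, q, r} ↔ ∃ a b c : ℝ, 0 ≤ a ∧ 0 ≤ b ∧ 0 ≤ c ∧ a + b + c = 1 ∧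
      z.1 = a * p.1 + b * q.1 + c * r.1 ∧ z.2 = a * p.2 + b * q.2 + c * r.2 := by
  constructor
  · intro hz
    rw [convexHull_insert (insert_nonempty _ _), convexHull_pair, mem_convexJoin] at hz
    obtain ⟨_, rfl, w, ⟨s, t, hs, ht, hst, rfl⟩, u, v, hu, hv, huv, rfl⟩ := hz
    refine ⟨u, v * s, v * t, hu, mul_nonneg hv hs, mul_nonneg hv ht, ?_, ?_, ?_⟩
    · rw [add_assoc, ← mul_add, hst, mul_one, huv]
    · simp; ring
    · simp; ring
  · rintro ⟨a, b, c, ha, hb, hc, h, h1, h2⟩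
    refine mem_convexHull_of_exists_fintype ![a, b, c] ![p, q, r] ?_ ?_ ?_ ?_
    · simp [Fin.forall_fin_succ, *]
    · simp [Fin.sum_univ_three, h]
    · simp [Fin.forall_fin_succ]
    · ext <;> simp [Fin.sum_univ_three, h1, h2]

theorem triDet_rotate (p q r : ℝ × ℝ) : triDet q r p = triDet p q r := by
  unfold triDet; ring

theorem triDet_swap (p q r : ℝ × ℝ) : triDet q p r = -triDet p q r := by
  unfold triDet; ring

theorem mem_extremePoints_of_triDet_ne_zero {p q r : ℝ × ℝ} (h : triDet p q r ≠ 0) :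
    p ∈ (convexHull ℝ {p, q, r}).extremePoints ℝ := by
  rw [mem_extremePoints_iff_left]
  refine ⟨subset_convexHull _ _ (by simp), ?_⟩
  rintro x hx y hy ⟨s, t, hs, ht, hst, hp⟩
  obtain ⟨a, b, c, ha, hb, hc, h0, h1, h2⟩ := mem_convexHull_triple.1 hx
  obtain ⟨a', b', c', ha', hb', hc', h0', h1', h2'⟩ := mem_convexHull_triple.1 hy
  have e1 : s * x.1 + t * y.1 = p.1 := by simpa using congrArg Prod.fst hp
  have e2 : s * x.2 + t * y.2 = p.2 := by simpa using congrArg Prod.snd hp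
  rw [h1, h1'] at e1
  rw [h2, h2'] at e2
  have f : (s * a + t * a' - 1) * triDet p q r = 0 := by
    obtain rfl : a = 1 - b - c := by linarith
    obtain rfl : a' = 1 - b' - c' := by linarith
    obtain rfl : s = 1 - t := by linarith
    unfold triDet
    linear_combination (q.2 - r.2) * e1 - (q.1 - r.1) * e2
  have f' : s * a + t * a' = 1 := by
    rcases mul_eq_zero.1 f with f | f
    · linarith
    · exact absurd f h
  have ha1 : a = 1 := by
    refine le_antisymm (by linarith) ?_
    by_contra! hlt
    nlinarith [mul_lt_mul_of_pos_left hlt hs, mul_le_mul_of_nonneg_left (show a' ≤ 1 by linarith)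
      ht.le]
  have hb0 : b = 0 := by linarith
  have hc0 : c = 0 := by linarith
  subst ha1 hb0 hc0
  ext <;> simp [h1, h2]

theorem mem_of_convexHull_eq {p q r p' q' r' : ℝ × ℝ} (h : triDet p q r ≠ 0)
    (he : convexHull ℝ {p, q, r} = convexHull ℝ {p', q', r'}) :
    p = p' ∨ p = q' ∨ p = r' := by
  have := mem_extremePoints_of_triDet_ne_zero h
  rw [he] at this
  simpa using extremePoints_convexHull_subset this

theorem insert_rotate {α : Type*} (p q r : α) : ({q, r, p} : Set α) = {p, q, r} := by
  rw [Set.pair_comm r p, Set.insert_comm]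

/-- Any presentation of a unimodular triangle as the hull of an affinely independent triple has
lattice vertices and determinant `±1`. -/
theorem IsUnimodularTriangle.of_eq {Δ : Set (ℝ × ℝ)} (hΔ : IsUnimodularTriangle Δ)
    {p q r : ℝ × ℝ} (h : AffineIndependent ℝ ![p, q, r]) (he : Δ = convexHull ℝ {p, q, r}) :
    IsLatticePoint p ∧ IsLatticePoint q ∧ IsLatticePoint r ∧ |triDet p q r| = 1 := by
  obtain ⟨p', q', r', hp, hq, hr, -, he', hd⟩ := hΔ
  have h0 := triDet_ne_zero h
  rw [he] at he'
  have hP := mem_of_convexHull_eq h0 he'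
  have hQ : q = p' ∨ q = q' ∨ q = r' := mem_of_convexHull_eq (p := q) (q := r) (r := p) (by rwa [triDet_rotate])
    (by rwa [insert_rotate p q r])
  have hR : r = p' ∨ r = q' ∨ r = r' := mem_of_convexHull_eq (p := r) (q := p) (r := q) (by rwa [← triDet_rotate])
    (by rwa [← insert_rotate r p q])
  have hl : ∀ z, z = p' ∨ z = q' ∨ z = r' → IsLatticePoint z := by
    rintro z (rfl | rfl | rfl) <;> assumption
  refine ⟨hl _ hP, hl _ hQ, hl _ hR, ?_⟩
  rw [← hd]
  have hpq : p ≠ q := fun e => h0 (by subst e; unfold triDet; ring)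
  have hqr : q ≠ r := fun e => h0 (by subst e; unfold triDet; ring)
  have hpr : p ≠ r := fun e => h0 (by subst e; unfold triDet; ring)
  rw [abs_eq_abs]
  rcases hP with rfl | rfl | rfl <;> rcases hQ with rfl | rfl | rfl <;>
    rcases hR with rfl | rfl | rfl <;>
    first
      | exact absurd rfl hpq
      | exact absurd rfl hqr
      | exact absurd rfl hpr
      | (left; unfold triDet; ring1)
      | (right; unfold triDet; ring1)

theorem IsUnimodularTriangle.exists_int {Δ : Set (ℝ × ℝ)} (hΔ : IsUnimodularTriangle Δ) :
    ∃ p q r : ℝ × ℝ, IsLatticePoint p ∧ IsLatticePoint q ∧ IsLatticePoint r ∧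
      Δ = convexHull ℝ {p, q, r} ∧ |triDet p q r| = 1 := by
  obtain ⟨p, q, r, hp, hq, hr, -, he, hd⟩ := hΔ
  exact ⟨p, q, r, hp, hq, hr, he, hd⟩

theorem IsUnimodularTriangle.isCompact {Δ : Set (ℝ × ℝ)} (hΔ : IsUnimodularTriangle Δ) :
    IsCompact Δ := by
  obtain ⟨p, q, r, -, -, -, -, rfl, -⟩ := hΔ
  exact (Set.toFinite _).isCompact_convexHull ℝ

theorem IsUnimodularTriangle.convex {Δ : Set (ℝ × ℝ)} (hΔ : IsUnimodularTriangle Δ) :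
    Convex ℝ Δ := by
  obtain ⟨p, q, r, -, -, -, -, rfl, -⟩ := hΔ
  exact convex_convexHull _ _

theorem IsUnimodularTriangle.interior_nonempty {Δ : Set (ℝ × ℝ)} (hΔ : IsUnimodularTriangle Δ) :
    (interior Δ).Nonempty := by
  obtain ⟨p, q, r, -, -, -, h, rfl, -⟩ := hΔ
  have hr : Set.range ![p, q, r] = {p, q, r} := by
    ext z; simp [eq_comm]; tauto
  rw [interior_convexHull_nonempty_iff_affineSpan_eq_top, ← hr,
    h.affineSpan_eq_top_iff_card_eq_finrank_add_one]
  simp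

/-- A vertical chord of a unimodular triangle has length at most one. -/
theorem IsUnimodularTriangle.chord_le_one {Δ : Set (ℝ × ℝ)} (hΔ : IsUnimodularTriangle Δ)
    {x y₁ y₂ : ℝ} (h₁ : (x, y₁) ∈ Δ) (h₂ : (x, y₂) ∈ Δ) : y₂ ≤ y₁ + 1 := by
  obtain ⟨_, _, _, ⟨p₁, p₂, rfl⟩, ⟨q₁, q₂, rfl⟩, ⟨r₁, r₂, rfl⟩, rfl, hd⟩ := hΔ.exists_int
  obtain ⟨a, b, c, ha, hb, hc, h0, h1, h2⟩ := mem_convexHull_triple.1 h₁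
  obtain ⟨a', b', c', ha', hb', hc', h0', h1', h2'⟩ := mem_convexHull_triple.1 h₂
  have hd0 : triDet (p₁, p₂) (q₁, q₂) (r₁, r₂) ≠ 0 := by
    intro h; rw [h] at hd; norm_num at hd
  simp only at h1 h2 h1' h2'
  have k1 : (y₂ - y₁) * ((q₁ - r₁ : ℤ) : ℝ)
      = -(a' - a) * triDet (p₁, p₂) (q₁, q₂) (r₁, r₂) := by
    obtain rfl : c = 1 - a - b := by linarith
    obtain rfl : c' = 1 - a' - b' := by linarith
    rw [h2, h2']
    push_cast
    unfold triDet
    linear_combination (r₂ - q₂ : ℝ) * (h1' - h1)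
  have k2 : (y₂ - y₁) * ((r₁ - p₁ : ℤ) : ℝ)
      = -(b' - b) * triDet (p₁, p₂) (q₁, q₂) (r₁, r₂) := by
    obtain rfl : a = 1 - c - b := by linarith
    obtain rfl : a' = 1 - c' - b' := by linarith
    rw [h2, h2']
    push_cast
    unfold triDet
    linear_combination (p₂ - r₂ : ℝ) * (h1' - h1)
  have bound : ∀ (z : ℤ) (d : ℝ), z ≠ 0 → |d| ≤ 1 →
      (y₂ - y₁) * (z : ℝ) = -d * triDet (p₁, p₂) (q₁, q₂) (r₁, r₂) → y₂ ≤ y₁ + 1 := by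
    intro z d hz hd1 hk
    have h3 : |y₂ - y₁| * |(z : ℝ)| = |d| := by
      rw [← abs_mul, hk, abs_mul, hd, abs_neg, mul_one]
    have h4 : (1 : ℝ) ≤ |(z : ℝ)| := by exact_mod_cast Int.one_le_abs hz
    have h5 : |y₂ - y₁| ≤ 1 := by nlinarith [abs_nonneg (y₂ - y₁)]
    linarith [le_abs_self (y₂ - y₁)]
  by_cases hz : q₁ - r₁ = 0
  · by_cases hz' : r₁ - p₁ = 0
    · exfalso
      apply hd0
      obtain rfl : q₁ = r₁ := by linarith
      obtain rfl : q₁ = p₁ := by linarith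
      unfold triDet; simp
    · exact bound _ _ hz' (by rw [abs_le]; constructor <;> linarith) k2
  · exact bound _ _ hz (by rw [abs_le]; constructor <;> linarith) k1

/-! ### Lattice edges over non-integral abscissae -/

theorem exists_two_mem_of_separated {p q r : ℝ × ℝ} (hd : triDet p q r ≠ 0) {x : ℝ}
    (hq : (p.1 - x) * (q.1 - x) < 0) (hr : (p.1 - x) * (r.1 - x) < 0) :
    ∃ y₁ y₂ : ℝ, y₁ ≠ y₂ ∧ (x, y₁) ∈ convexHull ℝ {p, q, r} ∧
      (x, y₂) ∈ convexHull ℝ {p, q, r} := by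
  have hq0 : q.1 - p.1 ≠ 0 := fun h => by
    rw [sub_eq_zero.1 h] at hq; exact hq.not_ge (mul_self_nonneg _)
  have hr0 : r.1 - p.1 ≠ 0 := fun h => by
    rw [sub_eq_zero.1 h] at hr; exact hr.not_ge (mul_self_nonneg _)
  have hs : ∀ u : ℝ, (p.1 - x) * (u - x) < 0 →
      0 ≤ (x - p.1) / (u - p.1) ∧ 0 ≤ 1 - (x - p.1) / (u - p.1) := by
    intro u hu
    rcases mul_neg_iff.1 hu with ⟨h1, h2⟩ | ⟨h1, h2⟩
    · have h3 : u - p.1 < 0 := by linarith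
      refine ⟨div_nonneg_of_nonpos (by linarith) h3.le, ?_⟩
      rw [sub_nonneg, div_le_one_of_neg h3]; linarith
    · have h3 : 0 < u - p.1 := by linarith
      refine ⟨div_nonneg (by linarith) h3.le, ?_⟩
      rw [sub_nonneg, div_le_one h3]; linarith
  obtain ⟨hs1, hs2⟩ := hs _ hq
  obtain ⟨ht1, ht2⟩ := hs _ hr
  have es : (x - p.1) / (q.1 - p.1) * (q.1 - p.1) = x - p.1 := div_mul_cancel₀ _ hq0
  have et : (x - p.1) / (r.1 - p.1) * (r.1 - p.1) = x - p.1 := div_mul_cancel₀ _ hr0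
  set s := (x - p.1) / (q.1 - p.1)
  set t := (x - p.1) / (r.1 - p.1)
  refine ⟨(1 - s) * p.2 + s * q.2, (1 - t) * p.2 + t * r.2, ?_,
    mem_convexHull_triple.2 ⟨1 - s, s, 0, hs2, hs1, le_rfl, by ring, by simp; linarith,
      by simp⟩,
    mem_convexHull_triple.2 ⟨1 - t, 0, t, ht2, le_rfl, ht1, by ring, by simp; linarith,
      by simp⟩⟩
  intro h
  have hx : x - p.1 ≠ 0 := fun h => by rw [← neg_sub, h] at hq; simp at hq
  have : (x - p.1) * triDet p q r = 0 := by
    unfold triDet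
    linear_combination (q.1 - p.1) * (r.1 - p.1) * (-h)
      - (q.1 - p.1) * (r.2 - p.2) * et + (q.2 - p.2) * (r.1 - p.1) * es
  rcases mul_eq_zero.1 this with h | h
  · exact hx h
  · exact hd h

/-- The reals that are not integers. -/
def nonIntegers : Set ℝ := (Set.range ((↑) : ℤ → ℝ))ᶜ

theorem ne_intCast_of_mem_nonIntegers {x : ℝ} (hx : x ∈ nonIntegers) (k : ℤ) : (k : ℝ) ≠ x :=
  fun h => hx ⟨k, h⟩

theorem dense_nonIntegers : Dense nonIntegers :=
  (Set.countable_range _).dense_compl ℝ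

theorem mem_nonIntegers {x : ℝ} {k : ℤ} (h1 : (k : ℝ) < x) (h2 : x < k + 1) :
    x ∈ nonIntegers := by
  rintro ⟨l, rfl⟩
  have h3 : k < l := by exact_mod_cast h1
  have h4 : l < k + 1 := by exact_mod_cast h2
  omega

theorem IsUnimodularTriangle.exists_ne_mem {Δ : Set (ℝ × ℝ)} (hΔ : IsUnimodularTriangle Δ)
    {x y : ℝ} (hx : x ∈ nonIntegers) (h : (x, y) ∈ Δ) : ∃ y', y' ≠ y ∧ (x, y') ∈ Δ := by
  suffices ∃ y₁ y₂, y₁ ≠ y₂ ∧ (x, y₁) ∈ Δ ∧ (x, y₂) ∈ Δ by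
    obtain ⟨y₁, y₂, hne, h1, h2⟩ := this
    by_cases hy : y₁ = y
    · exact ⟨y₂, fun e => hne (hy.trans e.symm), h2⟩
    · exact ⟨y₁, hy, h1⟩
  obtain ⟨p, q, r, ⟨p₁, p₂, hp⟩, ⟨q₁, q₂, hq⟩, ⟨r₁, r₂, hr⟩, rfl, hd⟩ := hΔ.exists_int
  have hd0 : triDet p q r ≠ 0 := fun h => by rw [h] at hd; norm_num at hd
  obtain ⟨a, b, c, ha, hb, hc, h0, h1, -⟩ := mem_convexHull_triple.1 h
  simp only at h1
  have np : p.1 - x ≠ 0 := by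
    rw [hp]; exact sub_ne_zero.2 (ne_intCast_of_mem_nonIntegers hx _)
  have nq : q.1 - x ≠ 0 := by
    rw [hq]; exact sub_ne_zero.2 (ne_intCast_of_mem_nonIntegers hx _)
  have nr : r.1 - x ≠ 0 := by
    rw [hr]; exact sub_ne_zero.2 (ne_intCast_of_mem_nonIntegers hx _)
  have hsum : a * (p.1 - x) + b * (q.1 - x) + c * (r.1 - x) = 0 := by
    linear_combination -h1 - x * h0
  have same : ∀ ε : ℝ, ε ≠ 0 → 0 ≤ ε * (p.1 - x) → 0 ≤ ε * (q.1 - x) → 0 ≤ ε * (r.1 - x) →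
      False := by
    intro ε hε kp kq kr
    have hsum' : a * (ε * (p.1 - x)) + b * (ε * (q.1 - x)) + c * (ε * (r.1 - x)) = 0 := by
      linear_combination ε * hsum
    have zp := mul_nonneg ha kp
    have zq := mul_nonneg hb kq
    have zr := mul_nonneg hc kr
    have ea : a = 0 :=
      (mul_eq_zero.1 (by linarith : a * (ε * (p.1 - x)) = 0)).resolve_right (mul_ne_zero hε np)
    have eb : b = 0 :=
      (mul_eq_zero.1 (by linarith : b * (ε * (q.1 - x)) = 0)).resolve_right (mul_ne_zero hε nq)
    have ec : c = 0 :=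
      (mul_eq_zero.1 (by linarith : c * (ε * (r.1 - x)) = 0)).resolve_right (mul_ne_zero hε nr)
    linarith
  have hP := @exists_two_mem_of_separated p q r hd0 x
  have hQ := @exists_two_mem_of_separated q r p (by rwa [triDet_rotate]) x
  have hR := @exists_two_mem_of_separated r p q (by rwa [← triDet_rotate]) x
  rw [insert_rotate p q r] at hQ
  rw [← insert_rotate r p q] at hR
  rcases lt_or_gt_of_ne np with gp | gp <;> rcases lt_or_gt_of_ne nq with gq | gq <;>
    rcases lt_or_gt_of_ne nr with gr | gr
  · exact (same (-1) (by norm_num) (by linarith) (by linarith) (by linarith)).elim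
  · exact hR (mul_neg_of_pos_of_neg gr gp) (mul_neg_of_pos_of_neg gr gq)
  · exact hQ (mul_neg_of_pos_of_neg gq gr) (mul_neg_of_pos_of_neg gq gp)
  · exact hP (mul_neg_of_neg_of_pos gp gq) (mul_neg_of_neg_of_pos gp gr)
  · exact hP (mul_neg_of_pos_of_neg gp gq) (mul_neg_of_pos_of_neg gp gr)
  · exact hQ (mul_neg_of_neg_of_pos gq gr) (mul_neg_of_neg_of_pos gq gp)
  · exact hR (mul_neg_of_neg_of_pos gr gp) (mul_neg_of_neg_of_pos gr gq)
  · exact (same 1 (by norm_num) (by linarith) (by linarith) (by linarith)).elim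

theorem mem_segment_prod {p q z : ℝ × ℝ} (h : z ∈ segment ℝ p q) :
    ∃ t : ℝ, 0 ≤ t ∧ t ≤ 1 ∧ z.1 = p.1 + t * (q.1 - p.1) ∧ z.2 = p.2 + t * (q.2 - p.2) := by
  obtain ⟨s, t, hs, ht, hst, rfl⟩ := h
  obtain rfl : s = 1 - t := by linarith
  exact ⟨t, ht, by linarith, by simp; ring, by simp; ring⟩

theorem isCoprime_of_abs_triDet {p₁ p₂ q₁ q₂ r₁ r₂ : ℤ}
    (h : |triDet (p₁, p₂) (q₁, q₂) (r₁, r₂)| = 1) : IsCoprime (q₁ - p₁) (q₂ - p₂) := by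
  simp only [triDet] at h
  rcases (abs_eq one_pos.le).1 h with h | h
  · exact ⟨r₂ - p₂, -(r₁ - p₁), by
      have : (q₁ - p₁) * (r₂ - p₂) - (q₂ - p₂) * (r₁ - p₁) = 1 := by exact_mod_cast h
      linarith⟩
  · exact ⟨-(r₂ - p₂), r₁ - p₁, by
      have : (q₁ - p₁) * (r₂ - p₂) - (q₂ - p₂) * (r₁ - p₁) = -1 := by exact_mod_cast h
      linarith⟩

/-- A side of a unimodular triangle over a non-integral abscissa, with endpoints sorted. -/
theorem exists_sorted_edge {p q r : ℝ × ℝ} (hp : IsLatticePoint p) (hq : IsLatticePoint q)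
    (hr : IsLatticePoint r) (hd : |triDet p q r| = 1) {x y : ℝ} (hx : x ∈ nonIntegers)
    (h : (x, y) ∈ segment ℝ p q) : ∃ i a j b : ℤ, (i : ℝ) < x ∧ x < j ∧
      IsCoprime (j - i) (b - a) ∧
      segment ℝ ((i : ℝ), (a : ℝ)) ((j : ℝ), (b : ℝ)) = segment ℝ p q := by
  obtain ⟨p₁, p₂, rfl⟩ := hp
  obtain ⟨q₁, q₂, rfl⟩ := hq
  obtain ⟨r₁, r₂, rfl⟩ := hr
  obtain ⟨t, ht0, ht1, hx1, -⟩ := mem_segment_prod h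
  simp only at hx1
  have np := ne_intCast_of_mem_nonIntegers hx p₁
  have nq := ne_intCast_of_mem_nonIntegers hx q₁
  rcases lt_or_gt_of_ne np with gp | gp
  · refine ⟨p₁, p₂, q₁, q₂, gp, lt_of_le_of_ne ?_ nq.symm, isCoprime_of_abs_triDet hd, rfl⟩
    by_contra! hlt
    have hpq : (p₁ : ℝ) < q₁ := by
      by_contra! hle
      linarith [mul_nonneg ht0 (sub_nonneg.2 hle)]
    linarith [mul_nonneg (sub_nonneg.2 ht1) (sub_pos.2 hpq).le]
  · refine ⟨q₁, q₂, p₁, p₂, lt_of_le_of_ne ?_ nq, gp, ?_, segment_symm _ _ _⟩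
    · by_contra! hlt
      have hpq : (q₁ : ℝ) < p₁ := by
        by_contra! hle
        linarith [mul_nonneg ht0 (sub_nonneg.2 hle)]
      linarith [mul_nonneg (sub_nonneg.2 ht1) (sub_pos.2 hpq).le]
    · exact isCoprime_of_abs_triDet (by rw [triDet_swap, abs_neg]; exact hd)

theorem IsFaceOf.eq_of_two_mem {F Δ : Set (ℝ × ℝ)} (hF : IsFaceOf F Δ)
    (hΔ : IsUnimodularTriangle Δ) {x y₁ y₂ : ℝ} (hx : x ∈ nonIntegers) (h₁ : (x, y₁) ∈ F)
    (h₂ : (x, y₂) ∈ F) (hne : y₁ ≠ y₂) : F = Δ := by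
  obtain ⟨p, q, r, hpqr, he, hF⟩ := hF
  obtain ⟨hp, hq, hr, -⟩ := hΔ.of_eq hpqr he
  have hpt : ∀ z : ℝ × ℝ, IsLatticePoint z → F = {z} → False := by
    rintro _ - rfl
    exact hne (congrArg Prod.snd (h₁.trans h₂.symm))
  have hseg : ∀ u v : ℝ × ℝ, IsLatticePoint u → F = segment ℝ u v → False := by
    rintro _ v ⟨u₁, u₂, rfl⟩ rfl
    obtain ⟨s, -, -, hs1, hs2⟩ := mem_segment_prod h₁
    obtain ⟨t, -, -, ht1, ht2⟩ := mem_segment_prod h₂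
    simp only at hs1 hs2 ht1 ht2
    have hst : s ≠ t := by rintro rfl; exact hne (by rw [hs2, ht2])
    have h0 : v.1 - u₁ = 0 := by
      have : (s - t) * (v.1 - u₁) = 0 := by linarith
      exact (mul_eq_zero.1 this).resolve_left (sub_ne_zero.2 hst)
    rw [h0] at hs1
    exact ne_intCast_of_mem_nonIntegers hx u₁ (by linarith)
  rcases hF with h | h | h | h | h | h | h | h
  · rw [h] at h₁; exact h₁.elim
  · exact (hpt _ hp h).elim
  · exact (hpt _ hq h).elim
  · exact (hpt _ hr h).elim
  · exact (hseg _ _ hp h).elim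
  · exact (hseg _ _ hq h).elim
  · exact (hseg _ _ hp h).elim
  · exact h

theorem IsFaceOf.exists_edge {F Δ : Set (ℝ × ℝ)} (hF : IsFaceOf F Δ)
    (hΔ : IsUnimodularTriangle Δ) (hne : F ≠ Δ) {x y : ℝ} (hx : x ∈ nonIntegers)
    (h : (x, y) ∈ F) : ∃ i a j b : ℤ, (i : ℝ) < x ∧ x < j ∧ IsCoprime (j - i) (b - a) ∧
      segment ℝ ((i : ℝ), (a : ℝ)) ((j : ℝ), (b : ℝ)) = F := by
  obtain ⟨p, q, r, hpqr, he, hF⟩ := hF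
  obtain ⟨hp, hq, hr, hd⟩ := hΔ.of_eq hpqr he
  have hpt : ∀ z : ℝ × ℝ, IsLatticePoint z → F = {z} → False := by
    rintro _ ⟨u₁, u₂, rfl⟩ rfl
    exact ne_intCast_of_mem_nonIntegers hx u₁ (congrArg Prod.fst h).symm
  rcases hF with e | e | e | e | e | e | e | e
  · rw [e] at h; exact h.elim
  · exact (hpt _ hp e).elim
  · exact (hpt _ hq e).elim
  · exact (hpt _ hr e).elim
  · subst e; exact exists_sorted_edge hp hq hr hd hx h
  · subst e; exact exists_sorted_edge hq hr hp (by rwa [triDet_rotate]) hx h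
  · subst e; exact exists_sorted_edge hp hr hq (by rwa [← triDet_rotate, triDet_swap, abs_neg,
      ← triDet_rotate, ← triDet_rotate]) hx h
  · exact absurd e hne

/-- A unimodular triangle lying on one side of a horizontal line and meeting it over a
non-integral abscissa has a side on that line. -/
theorem IsUnimodularTriangle.exists_horizontal_edge {Δ : Set (ℝ × ℝ)}
    (hΔ : IsUnimodularTriangle Δ) {σ c x : ℝ} (hσ : σ ≠ 0) (hx : x ∈ nonIntegers)
    (h : (x, c) ∈ Δ) (hside : ∀ z ∈ Δ, 0 ≤ σ * (z.2 - c)) :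
    ∃ i a j b : ℤ, (i : ℝ) < x ∧ x < j ∧ IsCoprime (j - i) (b - a) ∧ (a : ℝ) = c ∧ (b : ℝ) = c ∧
      segment ℝ ((i : ℝ), (a : ℝ)) ((j : ℝ), (b : ℝ)) ⊆ Δ := by
  obtain ⟨p, q, r, hp, hq, hr, rfl, hd⟩ := hΔ.exists_int
  have side : ∀ (u v w : ℝ × ℝ), IsLatticePoint u → IsLatticePoint v → IsLatticePoint w →
      |triDet u v w| = 1 → (∀ z ∈ convexHull ℝ {u, v, w}, 0 ≤ σ * (z.2 - c)) → ∀ s t : ℝ,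
      0 ≤ s → 0 ≤ t → s + t = 1 → x = s * u.1 + t * v.1 → c = s * u.2 + t * v.2 →
      ∃ i a j b : ℤ, (i : ℝ) < x ∧ x < j ∧ IsCoprime (j - i) (b - a) ∧ (a : ℝ) = c ∧
        (b : ℝ) = c ∧
        segment ℝ ((i : ℝ), (a : ℝ)) ((j : ℝ), (b : ℝ)) ⊆ convexHull ℝ {u, v, w} := by
    intro u v w hu hv hw hd hside s t hs ht hst h1 h2
    obtain ⟨i, a, j, b, hi, hj, hc, he⟩ := exists_sorted_edge hu hv hw hd hx (y := c)
      ⟨s, t, hs, ht, hst, by ext <;> simp [h1, h2]⟩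
    have hsub : segment ℝ ((i : ℝ), (a : ℝ)) ((j : ℝ), (b : ℝ)) ⊆ convexHull ℝ {u, v, w} :=
      he ▸ segment_subset_convexHull (by simp) (by simp)
    have hs0 : s ≠ 0 := by
      rintro rfl
      obtain ⟨v₁, v₂, rfl⟩ := hv
      obtain rfl : t = 1 := by linarith
      exact ne_intCast_of_mem_nonIntegers hx v₁ (by simp at h1; exact h1.symm)
    have ht0 : t ≠ 0 := by
      rintro rfl
      obtain ⟨v₁, v₂, rfl⟩ := hu
      obtain rfl : s = 1 := by linarith
      exact ne_intCast_of_mem_nonIntegers hx v₁ (by simp at h1; exact h1.symm)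
    have hu' := hside u (subset_convexHull _ _ (by simp))
    have hv' := hside v (subset_convexHull _ _ (by simp))
    have hz : s * (σ * (u.2 - c)) + t * (σ * (v.2 - c)) = 0 := by
      linear_combination -σ * h2 - σ * c * hst
    have hz1 : s * (σ * (u.2 - c)) = 0 := le_antisymm
      (by linarith [mul_nonneg ht hv']) (mul_nonneg hs hu')
    have hz2 : t * (σ * (v.2 - c)) = 0 := by linarith
    have hu2 : u.2 = c := by simpa [hs0, hσ, sub_eq_zero] using hz1
    have hv2 : v.2 = c := by simpa [ht0, hσ, sub_eq_zero] using hz2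
    have hc2 : ∀ z ∈ segment ℝ u v, z.2 = c := by
      intro z hz
      obtain ⟨τ, -, -, -, h⟩ := mem_segment_prod hz
      rw [h, hu2, hv2]; ring
    exact ⟨i, a, j, b, hi, hj, hc, hc2 _ (he ▸ left_mem_segment ℝ _ _),
      hc2 _ (he ▸ right_mem_segment ℝ _ _), hsub⟩
  obtain ⟨α, β, γ, hα, hβ, hγ, h0, h1, h2⟩ := mem_convexHull_triple.1 h
  simp only at h1 h2
  by_cases hγ0 : γ = 0
  · subst hγ0
    exact side p q r hp hq hr hd hside α β hα hβ (by linarith) (by linarith) (by linarith)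
  by_cases hα0 : α = 0
  · subst hα0
    rw [← insert_rotate p q r] at hside ⊢
    exact side q r p hq hr hp (by rwa [triDet_rotate]) hside β γ hβ hγ (by linarith)
      (by linarith) (by linarith)
  by_cases hβ0 : β = 0
  · subst hβ0
    rw [insert_rotate r p q] at hside ⊢
    exact side r p q hr hp hq (by rwa [← triDet_rotate]) hside γ α hγ hα (by linarith)
      (by linarith) (by linarith)
  exfalso
  have hp' := mul_nonneg hα (hside p (subset_convexHull _ _ (by simp)))
  have hq' := mul_nonneg hβ (hside q (subset_convexHull _ _ (by simp)))
  have hr' := mul_nonneg hγ (hside r (subset_convexHull _ _ (by simp)))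
  have hz : α * (σ * (p.2 - c)) + β * (σ * (q.2 - c)) + γ * (σ * (r.2 - c)) = 0 := by
    linear_combination -σ * h2 - σ * c * h0
  have hz1 : α * (σ * (p.2 - c)) = 0 := by linarith
  have hz2 : β * (σ * (q.2 - c)) = 0 := by linarith
  have hz3 : γ * (σ * (r.2 - c)) = 0 := by linarith
  have hp2 : p.2 = c := by simpa [hα0, hσ, sub_eq_zero] using hz1
  have hq2 : q.2 = c := by simpa [hβ0, hσ, sub_eq_zero] using hz2
  have hr2 : r.2 = c := by simpa [hγ0, hσ, sub_eq_zero] using hz3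
  unfold triDet at hd
  rw [hp2, hq2, hr2] at hd
  simp at hd

/-! ### The upper boundary of a shape -/

/-- The height at abscissa `x` of the line through `(i, a)` and `(j, b)`. -/
def lineAt (i a j b : ℤ) (x : ℝ) : ℝ := a + (b - a) / (j - i) * (x - i)

/-- The segment from `(i, a)` to `(j, b)` is primitive and separates `S` from `B` over `(i, j)`. -/
structure IsRoof (m n : ℕ) (S B : Set (ℝ × ℝ)) (i a j b : ℤ) : Prop where
  lt : i < j
  left_nonneg : 0 ≤ i
  right_le : j ≤ m
  left_height : 0 ≤ a ∧ a ≤ n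
  right_height : 0 ≤ b ∧ b ≤ n
  coprime : IsCoprime (j - i) (b - a)
  mem_lower : ∀ x ∈ nonIntegers, (i : ℝ) < x → x < j → ∀ y : ℝ, 0 ≤ y → y ≤ n →
    y < lineAt i a j b x → (x, y) ∈ S
  mem_upper : ∀ x ∈ nonIntegers, (i : ℝ) < x → x < j → ∀ y : ℝ, 0 ≤ y → y ≤ n →
    lineAt i a j b x < y → (x, y) ∈ B

/-- The properties of a shape `S` and of the region `B` above it that determine `S`
from its upper boundary. -/
structure IsShapePair (m n : ℕ) (S B : Set (ℝ × ℝ)) : Prop where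
  isClosed_lower : IsClosed S
  isClosed_upper : IsClosed B
  union_eq : S ∪ B = Set.Icc (0, 0) ((m : ℝ), (n : ℝ))
  le_of_mem : ∀ x ∈ nonIntegers, ∀ y₁ y₂, (x, y₁) ∈ B → (x, y₂) ∈ S → y₂ ≤ y₁
  le_add_one : ∀ x y₁ y₂ : ℝ, (x, y₁) ∈ B → (x, y₂) ∈ S → y₂ ≤ y₁ + 1
  exists_roof : ∀ k : ℤ, 0 ≤ k → k < m →
    ∃ i a j b : ℤ, IsRoof m n S B i a j b ∧ i ≤ k ∧ k + 1 ≤ j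
  subset_closure : S ⊆ closure {z | z.1 ∈ nonIntegers ∧ 0 ≤ z.2 ∧ ∃ y', z.2 < y' ∧ (z.1, y') ∈ S}

theorem lineAt_mem_segment {i a j b : ℤ} {x : ℝ} (hi : (i : ℝ) < x) (hj : x < j) :
    (x, lineAt i a j b x) ∈ segment ℝ ((i : ℝ), (a : ℝ)) ((j : ℝ), (b : ℝ)) := by
  have h : (0 : ℝ) < j - i := by linarith
  refine ⟨(j - x) / (j - i), (x - i) / (j - i), div_nonneg (by linarith) h.le,
    div_nonneg (by linarith) h.le, by field_simp; ring, ?_⟩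
  unfold lineAt
  ext <;> simp <;> field_simp <;> ring

theorem isRoof_of_separates {m n : ℕ} {S B : Set (ℝ × ℝ)}
    (hu : S ∪ B = Set.Icc (0, 0) ((m : ℝ), (n : ℝ))) {i a j b k : ℤ} {x₀ : ℝ}
    (hk : (k : ℝ) < x₀) (hk' : x₀ < k + 1) (hi : (i : ℝ) < x₀) (hj : x₀ < j)
    (hc : IsCoprime (j - i) (b - a))
    (hseg : segment ℝ ((i : ℝ), (a : ℝ)) ((j : ℝ), (b : ℝ)) ⊆
      Set.Icc (0, 0) ((m : ℝ), (n : ℝ)))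
    (hS : ∀ x ∈ nonIntegers, (i : ℝ) < x → x < j → ∀ y, (x, y) ∈ S → y ≤ lineAt i a j b x)
    (hB : ∀ x ∈ nonIntegers, (i : ℝ) < x → x < j → ∀ y, (x, y) ∈ B → lineAt i a j b x ≤ y) :
    ∃ i a j b : ℤ, IsRoof m n S B i a j b ∧ i ≤ k ∧ k + 1 ≤ j := by
  have hl := hseg (left_mem_segment ℝ _ _)
  have hr := hseg (right_mem_segment ℝ _ _)
  simp only [Set.mem_Icc, Prod.le_def] at hl hr
  have hik : i < k + 1 := by exact_mod_cast hi.trans hk'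
  have hkj : k < j := by exact_mod_cast hk.trans hj
  have hcover : ∀ x : ℝ, (i : ℝ) < x → x < j → ∀ y : ℝ, 0 ≤ y → y ≤ n →
      (x, y) ∈ S ∪ B := by
    intro x h1 h2 y h3 h4
    rw [hu]
    exact ⟨⟨by simp; linarith, h3⟩, ⟨by simp; linarith, h4⟩⟩
  refine ⟨i, a, j, b, ⟨by exact_mod_cast hi.trans hj, by exact_mod_cast hl.1.1,
    by exact_mod_cast hr.2.1, ⟨by exact_mod_cast hl.1.2, by exact_mod_cast hl.2.2⟩,
    ⟨by exact_mod_cast hr.1.2, by exact_mod_cast hr.2.2⟩, hc, ?_, ?_⟩, by omega, by omega⟩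
  · intro x hx h1 h2 y h3 h4 h5
    exact (hcover x h1 h2 y h3 h4).resolve_right fun h => (hB x hx h1 h2 y h).not_gt h5
  · intro x hx h1 h2 y h3 h4 h5
    exact (hcover x h1 h2 y h3 h4).resolve_left fun h => (hS x hx h1 h2 y h).not_gt h5

theorem IsUnimodularTriangulation.eq_of_two_mem {P : Set (ℝ × ℝ)} {T : Set (Set (ℝ × ℝ))}
    (hT : IsUnimodularTriangulation P T) {Δ Δ' : Set (ℝ × ℝ)} (hΔ : Δ ∈ T) (hΔ' : Δ' ∈ T)
    {x y₁ y₂ : ℝ} (hx : x ∈ nonIntegers) (h₁ : (x, y₁) ∈ Δ) (h₂ : (x, y₂) ∈ Δ)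
    (h₁' : (x, y₁) ∈ Δ') (h₂' : (x, y₂) ∈ Δ') (hne : y₁ ≠ y₂) : Δ = Δ' := by
  have h := hT.2.2.2 Δ hΔ Δ' hΔ'
  rw [← h.1.eq_of_two_mem (hT.2.1 Δ hΔ).1 hx ⟨h₁, h₁'⟩ ⟨h₂, h₂'⟩ hne]
  exact h.2.eq_of_two_mem (hT.2.1 Δ' hΔ').1 hx ⟨h₁, h₁'⟩ ⟨h₂, h₂'⟩ hne

theorem Convex.mem_of_vertical_between {D : Set (ℝ × ℝ)} (hD : Convex ℝ D) {x u v w : ℝ}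
    (hu : (x, u) ∈ D) (hv : (x, v) ∈ D) (huw : u ≤ w) (hwv : w ≤ v) : (x, w) ∈ D := by
  have h : Convex ℝ ((fun y : ℝ => (x, y)) ⁻¹' D) := by
    intro s hs t ht α β hα hβ hαβ
    have := hD hs ht hα hβ hαβ
    have e : α • (x, s) + β • (x, t) = (x, α • s + β • t) := by
      ext <;> simp
      rw [← add_mul, hαβ, one_mul]
    rwa [e] at this
  exact h.ordConnected.out hu hv ⟨huw, hwv⟩

theorem IsUnimodularTriangulation.le_of_not_liesAbove {P : Set (ℝ × ℝ)}
    {T : Set (Set (ℝ × ℝ))} (hT : IsUnimodularTriangulation P T) {Δ Δ' : Set (ℝ × ℝ)}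
    (hΔ : Δ ∈ T) (hΔ' : Δ' ∈ T) (hne : Δ ≠ Δ') (hlow : ¬ LiesAbove Δ Δ') {x y₁ y₂ : ℝ}
    (hx : x ∈ nonIntegers) (h₁ : (x, y₁) ∈ Δ) (h₂ : (x, y₂) ∈ Δ') : y₂ ≤ y₁ := by
  by_contra! hlt
  have huni : ∀ {u v : ℝ}, (x, u) ∈ Δ → (x, v) ∈ Δ → (x, u) ∈ Δ' → (x, v) ∈ Δ' → u = v := by
    intro u v a b c d
    by_contra h
    exact hne (hT.eq_of_two_mem hΔ hΔ' hx a b c d h)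
  have hcase : ∀ {u v : ℝ}, (x, u) ∈ Δ → (x, v) ∈ Δ' → u < v → (x, u) ∈ Δ' ∨ (x, v) ∈ Δ := by
    intro u v hu hv huv
    by_contra! h
    exact hlow ⟨x, u, v, ⟨hu, h.1⟩, ⟨hv, h.2⟩, huv⟩
  have cΔ := (hT.2.1 Δ hΔ).1.convex
  have cΔ' := (hT.2.1 Δ' hΔ').1.convex
  rcases hcase h₁ h₂ hlt with h | h
  · obtain ⟨y, hy, hyΔ⟩ := (hT.2.1 Δ hΔ).1.exists_ne_mem hx h₁
    rcases lt_or_gt_of_ne hy with hy | hy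
    · rcases hcase hyΔ h₂ (hy.trans hlt) with h' | h'
      · exact hy.ne (huni hyΔ h₁ h' h)
      · exact hlt.ne (huni h₁ h' h h₂)
    · have hm : y₁ < min y y₂ := lt_min hy hlt
      exact hm.ne (huni h₁ (cΔ.mem_of_vertical_between h₁ hyΔ hm.le (min_le_left _ _)) h
        (cΔ'.mem_of_vertical_between h h₂ hm.le (min_le_right _ _)))
  · obtain ⟨y, hy, hyΔ'⟩ := (hT.2.1 Δ' hΔ').1.exists_ne_mem hx h₂
    rcases lt_or_gt_of_ne hy with hy | hy
    · have hm : max y y₁ < y₂ := max_lt hy hlt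
      exact hm.ne (huni (cΔ.mem_of_vertical_between h₁ h (le_max_right _ _) hm.le) h
        (cΔ'.mem_of_vertical_between hyΔ' h₂ (le_max_left _ _) hm.le) h₂)
    · rcases hcase h₁ hyΔ' (hlt.trans hy) with h' | h'
      · exact hlt.ne (huni h₁ h h' h₂)
      · exact hy.ne (huni h h' h₂ hyΔ')

theorem IsUnimodularTriangulation.isShapePair {m n : ℕ} {T U : Set (Set (ℝ × ℝ))}
    (hT : IsUnimodularTriangulation (Set.Icc (0, 0) ((m : ℝ), (n : ℝ))) T) (hU : U ⊆ T)
    (hlow : ∀ Δ' ∈ U, ∀ Δ ∈ T, LiesAbove Δ Δ' → Δ ∈ U) :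
    IsShapePair m n (⋃₀ U) (⋃₀ (T \ U)) := by
  have hclosed : ∀ V ⊆ T, IsClosed (⋃₀ V) := fun V hV =>
    Set.sUnion_eq_biUnion ▸ (hT.1.subset hV).isClosed_biUnion fun Δ hΔ =>
      (hT.2.1 Δ (hV hΔ)).1.isCompact.isClosed
  have hS := hclosed U hU
  have hB := hclosed (T \ U) Set.sdiff_subset
  have hu : ⋃₀ U ∪ ⋃₀ (T \ U) = Set.Icc (0, 0) ((m : ℝ), (n : ℝ)) := by
    rw [← Set.sUnion_union, Set.union_sdiff_cancel hU, hT.2.2.1]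
  have hN : ∀ x ∈ nonIntegers, ∀ y₁ y₂, (x, y₁) ∈ ⋃₀ (T \ U) → (x, y₂) ∈ ⋃₀ U → y₂ ≤ y₁ := by
    rintro x hx y₁ y₂ ⟨Δ, ⟨hΔ, hΔU⟩, h₁⟩ ⟨Δ', hΔ', h₂⟩
    exact hT.le_of_not_liesAbove hΔ (hU hΔ') (fun e => hΔU (e ▸ hΔ'))
      (fun h => hΔU (hlow Δ' hΔ' Δ hΔ h)) hx h₁ h₂
  refine ⟨hS, hB, hu, hN, ?_, ?_, ?_⟩
  · rintro x y₁ y₂ ⟨Δ, ⟨hΔ, hΔU⟩, h₁⟩ ⟨Δ', hΔ', h₂⟩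
    by_cases h : (x, y₁) ∈ Δ'
    · exact (hT.2.1 Δ' (hU hΔ')).1.chord_le_one h h₂
    by_cases h' : (x, y₂) ∈ Δ
    · exact (hT.2.1 Δ hΔ).1.chord_le_one h₁ h'
    by_contra! hlt
    exact hΔU (hlow Δ' hΔ' Δ hΔ ⟨x, y₁, y₂, ⟨h₁, h⟩, ⟨h₂, h'⟩, by linarith⟩)
  · intro k hk0 hkm
    have hkm' : (k : ℝ) + 1 ≤ m := by exact_mod_cast hkm
    have hk0' : (0 : ℝ) ≤ k := by exact_mod_cast hk0
    obtain ⟨x, hx⟩ : ∃ x : ℝ, x = k + 1 / 2 := ⟨_, rfl⟩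
    have hxk : (k : ℝ) < x := by linarith
    have hxk' : x < k + 1 := by linarith
    have hxn : x ∈ nonIntegers := mem_nonIntegers hxk hxk'
    have hcover : ∀ y ∈ Set.Icc (0 : ℝ) n, (x, y) ∈ ⋃₀ U ∪ ⋃₀ (T \ U) := by
      intro y hy
      rw [hu]
      exact ⟨⟨by simp; linarith, hy.1⟩, ⟨by simp; linarith, hy.2⟩⟩
    have hcont : Continuous fun y : ℝ => (x, y) := by fun_prop
    by_cases hneS : ∃ y ∈ Set.Icc (0 : ℝ) n, (x, y) ∈ ⋃₀ U
    · by_cases hneB : ∃ y ∈ Set.Icc (0 : ℝ) n, (x, y) ∈ ⋃₀ (T \ U)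
      · obtain ⟨h, -, ⟨Δ', hΔ', h₂⟩, Δ, ⟨hΔ, hΔU⟩, h₁⟩ :=
          isPreconnected_closed_iff.1 (isPreconnected_Icc (a := (0 : ℝ)) (b := n)) _ _
            (hS.preimage hcont) (hB.preimage hcont) hcover hneS hneB
        have hne : Δ ≠ Δ' := fun e => hΔU (e ▸ hΔ')
        have hF := (hT.2.2.2 Δ hΔ Δ' (hU hΔ')).1
        have hFne : Δ ∩ Δ' ≠ Δ := by
          intro e
          obtain ⟨y, hy, hyΔ⟩ := (hT.2.1 Δ hΔ).1.exists_ne_mem hxn h₁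
          exact hne (hT.eq_of_two_mem hΔ (hU hΔ') hxn hyΔ h₁
            (Set.inter_eq_left.1 e hyΔ) (Set.inter_eq_left.1 e h₁) hy)
        obtain ⟨i, a, j, b, hi, hj, hc, he⟩ :=
          hF.exists_edge (hT.2.1 Δ hΔ).1 hFne hxn ⟨h₁, h₂⟩
        refine isRoof_of_separates hu hxk hxk' hi hj hc ?_ ?_ ?_
        · rw [he]; exact Set.inter_subset_left.trans (hT.2.1 Δ hΔ).2
        · intro x' hx' hix hxj y hy
          have := lineAt_mem_segment (a := a) (b := b) hix hxj
          rw [he] at this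
          exact hN x' hx' _ _ ⟨Δ, ⟨hΔ, hΔU⟩, this.1⟩ hy
        · intro x' hx' hix hxj y hy
          have := lineAt_mem_segment (a := a) (b := b) hix hxj
          rw [he] at this
          exact hN x' hx' _ _ hy ⟨Δ', hΔ', this.2⟩
      · push Not at hneB
        have hn : (n : ℝ) ∈ Set.Icc (0 : ℝ) n := ⟨by positivity, le_rfl⟩
        obtain ⟨Δ, hΔ, h₁⟩ := (hcover n hn).resolve_right (hneB n hn)
        obtain ⟨i, a, j, b, hi, hj, hc, ha, hb, he⟩ :=
          (hT.2.1 Δ (hU hΔ)).1.exists_horizontal_edge (σ := -1) (by norm_num) hxn h₁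
            (fun z hz => by have : z.2 ≤ n := ((hT.2.1 Δ (hU hΔ)).2 hz).2.2
                            linarith)
        have hline : ∀ x, lineAt i a j b x = n := by intro x; simp [lineAt, ha, hb]
        refine isRoof_of_separates hu hxk hxk' hi hj hc (he.trans (hT.2.1 Δ (hU hΔ)).2) ?_ ?_
        · intro x' hx' hix hxj y hy
          rw [hline]
          exact (hu.subset (Or.inl hy)).2.2
        · intro x' hx' hix hxj y hy
          exact hN x' hx' _ _ hy ⟨Δ, hΔ, he (lineAt_mem_segment hix hxj)⟩
    · push Not at hneS
      have hn : (0 : ℝ) ∈ Set.Icc (0 : ℝ) n := ⟨le_rfl, by positivity⟩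
      obtain ⟨Δ, hΔ, h₁⟩ := (hcover 0 hn).resolve_left (hneS 0 hn)
      obtain ⟨i, a, j, b, hi, hj, hc, ha, hb, he⟩ :=
        (hT.2.1 Δ hΔ.1).1.exists_horizontal_edge (σ := 1) (by norm_num) hxn h₁
          (fun z hz => by have : 0 ≤ z.2 := ((hT.2.1 Δ hΔ.1).2 hz).1.2
                          linarith)
      have hline : ∀ x, lineAt i a j b x = 0 := by intro x; simp [lineAt, ha, hb]
      refine isRoof_of_separates hu hxk hxk' hi hj hc (he.trans (hT.2.1 Δ hΔ.1).2) ?_ ?_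
      · intro x' hx' hix hxj y hy
        exact hN x' hx' _ _ ⟨Δ, hΔ, he (lineAt_mem_segment hix hxj)⟩ hy
      · intro x' hx' hix hxj y hy
        rw [hline]
        exact (hu.subset (Or.inr hy)).1.2
  · rintro z ⟨Δ, hΔ, hz⟩
    have hΔ1 := (hT.2.1 Δ (hU hΔ)).1
    have hdense : Dense (nonIntegers ×ˢ (Set.univ : Set ℝ)) := dense_nonIntegers.prod dense_univ
    have hcl : Δ ⊆ closure (interior Δ ∩ nonIntegers ×ˢ (Set.univ : Set ℝ)) :=
      calc Δ ⊆ closure Δ := _root_.subset_closure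
        _ = closure (interior Δ) :=
          (hΔ1.convex.closure_interior_eq_closure_of_nonempty_interior hΔ1.interior_nonempty).symm
        _ ⊆ _ := closure_minimal (hdense.open_subset_closure_inter isOpen_interior)
          isClosed_closure
    refine closure_mono ?_ (hcl hz)
    rintro ⟨x, y⟩ ⟨hxy, hx, -⟩
    refine ⟨hx, ((hT.2.1 Δ (hU hΔ)).2 (interior_subset hxy)).1.2, ?_⟩
    have hopen : IsOpen ((fun y : ℝ => (x, y)) ⁻¹' interior Δ) :=
      isOpen_interior.preimage (by fun_prop)
    obtain ⟨ε, hε, hball⟩ := Metric.isOpen_iff.1 hopen y hxy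
    refine ⟨y + ε / 2, by simp; linarith, Δ, hΔ, interior_subset (hball ?_)⟩
    simp [abs_of_pos hε]
    linarith

theorem lineAt_left (i a j b : ℤ) : lineAt i a j b i = a := by simp [lineAt]

theorem lineAt_right {i a j b : ℤ} (h : i < j) : lineAt i a j b j = b := by
  have : (j : ℝ) - i ≠ 0 := by
    have : (i : ℝ) < j := by exact_mod_cast h
    linarith
  unfold lineAt
  field_simp
  ring

theorem lineAt_ne_intCast {i a j b t : ℤ} (hc : IsCoprime (j - i) (b - a)) (hi : i < t)
    (hj : t < j) (c : ℤ) : lineAt i a j b t ≠ c := by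
  intro h
  have h0 : (j : ℝ) - i ≠ 0 := by
    have : (i : ℝ) < j := by exact_mod_cast hi.trans hj
    linarith
  unfold lineAt at h
  field_simp at h
  have h' : a * (j - i) + (b - a) * (t - i) = c * (j - i) := by
    have h2 : (a : ℝ) * (j - i) + (b - a) * (t - i) = c * (j - i) := by linarith
    exact_mod_cast h2
  have hdvd : j - i ∣ t - i := hc.dvd_of_dvd_mul_left ⟨c - a, by linarith⟩
  have := Int.le_of_dvd (by omega) hdvd
  omega

theorem IsRoof.lineAt_mem_Icc {m n : ℕ} {S B : Set (ℝ × ℝ)} {i a j b : ℤ}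
    (h : IsRoof m n S B i a j b) {x : ℝ} (hi : (i : ℝ) < x) (hj : x < j) :
    0 ≤ lineAt i a j b x ∧ lineAt i a j b x ≤ n := by
  obtain ⟨t, ht0, ht1, -, ht⟩ := mem_segment_prod (lineAt_mem_segment (a := a) (b := b) hi hj)
  simp only at ht
  rw [ht]
  have ha0 : (0 : ℝ) ≤ a := by exact_mod_cast h.left_height.1
  have ha1 : (a : ℝ) ≤ n := by exact_mod_cast h.left_height.2
  have hb0 : (0 : ℝ) ≤ b := by exact_mod_cast h.right_height.1
  have hb1 : (b : ℝ) ≤ n := by exact_mod_cast h.right_height.2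
  constructor <;> nlinarith

theorem IsShapePair.lineAt_le {m n : ℕ} {S B : Set (ℝ × ℝ)} (h : IsShapePair m n S B)
    {i a j b i' a' j' b' : ℤ} (r : IsRoof m n S B i a j b) (r' : IsRoof m n S B i' a' j' b')
    {x : ℝ} (hx : x ∈ nonIntegers) (hi : (i : ℝ) < x) (hj : x < j) (hi' : (i' : ℝ) < x)
    (hj' : x < j') : lineAt i a j b x ≤ lineAt i' a' j' b' x := by
  by_contra! hlt
  obtain ⟨h0, h1⟩ := r.lineAt_mem_Icc hi hj
  obtain ⟨h0', h1'⟩ := r'.lineAt_mem_Icc hi' hj'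
  obtain ⟨y₂, hy₂, hy₂'⟩ := exists_between hlt
  obtain ⟨y₁, hy₁, hy₁'⟩ := exists_between hy₂
  exact (h.le_of_mem x hx y₁ y₂
    (r'.mem_upper x hx hi' hj' y₁ (by linarith) (by linarith) hy₁)
    (r.mem_lower x hx hi hj y₂ (by linarith) (by linarith) hy₂')).not_gt hy₁'

theorem IsShapePair.lineAt_eq {m n : ℕ} {S B : Set (ℝ × ℝ)} (h : IsShapePair m n S B)
    {i a j b i' a' j' b' k : ℤ} (r : IsRoof m n S B i a j b) (r' : IsRoof m n S B i' a' j' b')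
    (hi : i ≤ k) (hj : k + 1 ≤ j) (hi' : i' ≤ k) (hj' : k + 1 ≤ j') :
    lineAt i a j b = lineAt i' a' j' b' := by
  have key : ∀ x : ℝ, (k : ℝ) < x → x < k + 1 → lineAt i a j b x = lineAt i' a' j' b' x := by
    intro x h1 h2
    have hx := mem_nonIntegers h1 h2
    have e1 : (i : ℝ) ≤ k := by exact_mod_cast hi
    have e2 : (k : ℝ) + 1 ≤ j := by exact_mod_cast hj
    have e3 : (i' : ℝ) ≤ k := by exact_mod_cast hi'
    have e4 : (k : ℝ) + 1 ≤ j' := by exact_mod_cast hj'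
    exact le_antisymm
      (h.lineAt_le r r' hx (by linarith) (by linarith) (by linarith) (by linarith))
      (h.lineAt_le r' r hx (by linarith) (by linarith) (by linarith) (by linarith))
  have k1 := key (k + 1 / 3) (by linarith) (by linarith)
  have k2 := key (k + 2 / 3) (by linarith) (by linarith)
  unfold lineAt at k1 k2
  funext x
  unfold lineAt
  linear_combination (2 - 3 * (x - k)) * k1 + (3 * (x - k) - 1) * k2

/-- The roof over a given unit interval is unique. -/
theorem IsShapePair.roof_unique {m n : ℕ} {S B : Set (ℝ × ℝ)} (h : IsShapePair m n S B)
    {i a j b i' a' j' b' k : ℤ} (r : IsRoof m n S B i a j b) (r' : IsRoof m n S B i' a' j' b')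
    (hi : i ≤ k) (hj : k + 1 ≤ j) (hi' : i' ≤ k) (hj' : k + 1 ≤ j') :
    i = i' ∧ a = a' ∧ j = j' ∧ b = b' := by
  have e := h.lineAt_eq r r' hi hj hi' hj'
  have ei : i = i' := by
    rcases lt_trichotomy i i' with hlt | heq | hlt
    · exact absurd (e ▸ lineAt_left i' a' j' b')
        (lineAt_ne_intCast r.coprime hlt (by omega) a')
    · exact heq
    · exact absurd (e ▸ lineAt_left i a j b)
        (lineAt_ne_intCast r'.coprime hlt (by omega) a)
  have ej : j = j' := by
    rcases lt_trichotomy j j' with hlt | heq | hlt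
    · exact absurd (e ▸ lineAt_right r.lt)
        (lineAt_ne_intCast r'.coprime (by omega) hlt b)
    · exact heq
    · exact absurd (e ▸ lineAt_right r'.lt)
        (lineAt_ne_intCast r.coprime (by omega) hlt b')
  subst ei ej
  refine ⟨rfl, ?_, rfl, ?_⟩
  · have := lineAt_left i a' j b'
    rw [← e, lineAt_left] at this
    exact_mod_cast this
  · have := lineAt_right (a := a') (b := b') r.lt
    rw [← e, lineAt_right r.lt] at this
    exact_mod_cast this

theorem IsRoof.mem_lower_of_closed {m n : ℕ} {S B : Set (ℝ × ℝ)} {i a j b : ℤ}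
    (r : IsRoof m n S B i a j b) (hS : IsClosed S) {x y : ℝ} (hx : x ∈ Set.Icc (i : ℝ) j)
    (hy : y ∈ Set.Icc (0 : ℝ) n) (h : y < lineAt i a j b x) : (x, y) ∈ S := by
  have hij : (i : ℝ) < j := by exact_mod_cast r.lt
  have hopen : IsOpen {x | y < lineAt i a j b x} := by
    unfold lineAt; exact isOpen_lt (by fun_prop) (by fun_prop)
  rw [← closure_Ioo hij.ne] at hx
  have h1 := hopen.inter_closure ⟨h, hx⟩
  have h2 := closure_minimal (dense_nonIntegers.open_subset_closure_inter
    (hopen.inter isOpen_Ioo)) isClosed_closure h1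
  refine closure_minimal ?_ (hS.preimage (by fun_prop : Continuous fun x : ℝ => (x, y))) h2
  rintro u ⟨⟨hu, hu'⟩, hu''⟩
  exact r.mem_lower u hu'' hu'.1 hu'.2 y hy.1 hy.2 hu

theorem IsRoof.mem_upper_of_closed {m n : ℕ} {S B : Set (ℝ × ℝ)} {i a j b : ℤ}
    (r : IsRoof m n S B i a j b) (hB : IsClosed B) {x y : ℝ} (hx : x ∈ Set.Icc (i : ℝ) j)
    (hy : y ∈ Set.Icc (0 : ℝ) n) (h : lineAt i a j b x < y) : (x, y) ∈ B := by
  have hij : (i : ℝ) < j := by exact_mod_cast r.lt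
  have hopen : IsOpen {x | lineAt i a j b x < y} := by
    unfold lineAt; exact isOpen_lt (by fun_prop) (by fun_prop)
  rw [← closure_Ioo hij.ne] at hx
  have h1 := hopen.inter_closure ⟨h, hx⟩
  have h2 := closure_minimal (dense_nonIntegers.open_subset_closure_inter
    (hopen.inter isOpen_Ioo)) isClosed_closure h1
  refine closure_minimal ?_ (hB.preimage (by fun_prop : Continuous fun x : ℝ => (x, y))) h2
  rintro u ⟨⟨hu, hu'⟩, hu''⟩
  exact r.mem_upper u hu'' hu'.1 hu'.2 y hy.1 hy.2 hu

/-- The heights of two roofs over a common endpoint differ by at most one. -/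
theorem IsShapePair.height_le_add_one {m n : ℕ} {S B : Set (ℝ × ℝ)} (h : IsShapePair m n S B)
    {i a j b i' a' j' b' k c c' : ℤ} (r : IsRoof m n S B i a j b)
    (r' : IsRoof m n S B i' a' j' b') (hk : (k : ℝ) ∈ Set.Icc (i : ℝ) j)
    (hk' : (k : ℝ) ∈ Set.Icc (i' : ℝ) j') (hc : lineAt i a j b k = c) (hc0 : 0 ≤ c)
    (hc' : lineAt i' a' j' b' k = c') (hcn' : c' ≤ n) : c' ≤ c + 1 := by
  by_contra! hlt
  have hlt' : (c : ℝ) + 2 ≤ c' := by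
    have h2 : c + 2 ≤ c' := by omega
    exact_mod_cast h2
  have h0 : (0 : ℝ) ≤ c := by exact_mod_cast hc0
  have h1 : (c' : ℝ) ≤ n := by exact_mod_cast hcn'
  have hB := r.mem_upper_of_closed h.isClosed_upper hk (y := c + 1 / 4)
    ⟨by linarith, by linarith⟩ (by rw [hc]; linarith)
  have hS := r'.mem_lower_of_closed h.isClosed_lower hk' (y := c' - 1 / 4)
    ⟨by linarith, by linarith⟩ (by rw [hc']; linarith)
  have := h.le_add_one _ _ _ hB hS
  linarith

/-! ### Encoding shapes -/

/-- `(I k, A k)` and `(J k, H k)` are the endpoints of the roof over `[k, k + 1]`. -/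
structure IsRoofChoice (m n : ℕ) (S B : Set (ℝ × ℝ)) (I A J H : ℤ → ℤ) : Prop where
  pair : IsShapePair m n S B
  roof : ∀ k : ℤ, 0 ≤ k → k < m → IsRoof m n S B (I k) (A k) (J k) (H k)
  le : ∀ k : ℤ, 0 ≤ k → k < m → I k ≤ k
  ge : ∀ k : ℤ, 0 ≤ k → k < m → k + 1 ≤ J k

theorem IsShapePair.exists_roofChoice {m n : ℕ} {S B : Set (ℝ × ℝ)} (h : IsShapePair m n S B) :
    ∃ I A J H : ℤ → ℤ, IsRoofChoice m n S B I A J H := by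
  have : ∀ k : ℤ, ∃ i a j b : ℤ, 0 ≤ k → k < m →
      IsRoof m n S B i a j b ∧ i ≤ k ∧ k + 1 ≤ j := by
    intro k
    by_cases hk : 0 ≤ k ∧ k < m
    · obtain ⟨i, a, j, b, hr⟩ := h.exists_roof k hk.1 hk.2
      exact ⟨i, a, j, b, fun _ _ => hr⟩
    · exact ⟨0, 0, 0, 0, fun h0 h1 => absurd ⟨h0, h1⟩ hk⟩
  choose I A J H hr using this
  exact ⟨I, A, J, H, h, fun k h0 h1 => (hr k h0 h1).1, fun k h0 h1 => (hr k h0 h1).2.1,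
    fun k h0 h1 => (hr k h0 h1).2.2⟩

namespace IsRoofChoice

variable {m n : ℕ} {S B S' B' : Set (ℝ × ℝ)} {I A J H I' A' J' H' : ℤ → ℤ}

theorem congr (h : IsRoofChoice m n S B I A J H) {k l : ℤ} (hk : 0 ≤ k) (hkm : k < m)
    (hl : I k ≤ l) (hl' : l + 1 ≤ J k) :
    I k = I l ∧ A k = A l ∧ J k = J l ∧ H k = H l := by
  have r := h.roof k hk hkm
  have h0 : 0 ≤ l := r.left_nonneg.trans hl
  have hm : l < m := by have := r.right_le; omega
  exact h.pair.roof_unique r (h.roof l h0 hm) hl hl' (h.le l h0 hm) (h.ge l h0 hm)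

theorem right_eq_iff (h : IsRoofChoice m n S B I A J H) {k : ℤ} (hk : 0 ≤ k) (hkm : k + 1 < m) :
    J k = k + 1 ↔ I (k + 1) = k + 1 := by
  have h1 := h.ge k hk (by omega)
  have h2 := h.le (k + 1) (by omega) hkm
  constructor <;> intro e
  · by_contra hne
    have h3 := (h.congr (k := k + 1) (l := k) (by omega) hkm (by omega)
      (by have := h.ge (k + 1) (by omega) hkm; omega)).2.2.1
    have := h.ge (k + 1) (by omega) hkm
    omega
  · by_contra hne
    have h3 := (h.congr (k := k) (l := k + 1) (by omega) (by omega)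
      (by have := h.le k (by omega) (by omega); omega) (by omega)).1
    have := h.le k (by omega) (by omega)
    omega

theorem left_le (h : IsRoofChoice m n S B I A J H) (h' : IsRoofChoice m n S' B' I' A' J' H')
    (hJ : ∀ k : ℤ, 0 ≤ k → k + 1 < m → (J k = k + 1 ↔ J' k = k + 1)) {k : ℤ} (hk : 0 ≤ k)
    (hkm : k < m) : I' k ≤ I k := by
  by_contra! hlt
  have r := h.roof k hk hkm
  have hle' := h'.le k hk hkm
  have hge := h.ge k hk hkm
  have hge' := h'.ge k hk hkm
  have h0 := r.left_nonneg
  have e1 := (h'.congr hk hkm le_rfl (by omega)).1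
  have e2 := (h.congr (l := I' k) hk hkm hlt.le (by omega)).1
  have i1 := h'.right_eq_iff (k := I' k - 1) (by omega) (by omega)
  have i2 := h.right_eq_iff (k := I' k - 1) (by omega) (by omega)
  have i3 := hJ (I' k - 1) (by omega) (by omega)
  rw [sub_add_cancel] at i1 i2 i3
  have := i2.1 (i3.2 (i1.2 e1.symm))
  omega

theorem right_le_right (h : IsRoofChoice m n S B I A J H)
    (h' : IsRoofChoice m n S' B' I' A' J' H')
    (hJ : ∀ k : ℤ, 0 ≤ k → k + 1 < m → (J k = k + 1 ↔ J' k = k + 1)) {k : ℤ} (hk : 0 ≤ k)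
    (hkm : k < m) : J k ≤ J' k := by
  by_contra! hlt
  have r := h.roof k hk hkm
  have hle := h.le k hk hkm
  have hle' := h'.le k hk hkm
  have hge' := h'.ge k hk hkm
  have hm := r.right_le
  have e1 := (h'.congr (l := J' k - 1) hk hkm (by omega) (by omega)).2.2.1
  have e2 := (h.congr (l := J' k - 1) hk hkm (by omega) (by omega)).2.2.1
  have i3 := hJ (J' k - 1) (by omega) (by omega)
  rw [sub_add_cancel] at i3
  have := i3.2 e1.symm
  omega

end IsRoofChoice

/-- The data of a family of roofs at the two outer columns and at each inner column. -/
def roofCode (m : ℕ) (A J H : ℤ → ℤ) : (ℤ × ℤ) × (Fin (m - 1) → Option (ℤ × ℤ)) :=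
  ((A 0, H (m - 1)), fun t => if J t = t + 1 then some (H t, A (t + 1)) else none)

namespace IsRoofChoice

variable {m n : ℕ} {S B S' B' : Set (ℝ × ℝ)} {I A J H I' A' J' H' : ℤ → ℤ}

theorem eq_of_roofCode_eq (h : IsRoofChoice m n S B I A J H)
    (h' : IsRoofChoice m n S' B' I' A' J' H') (hc : roofCode m A J H = roofCode m A' J' H')
    {k : ℤ} (hk : 0 ≤ k) (hkm : k < m) :
    I k = I' k ∧ A k = A' k ∧ J k = J' k ∧ H k = H' k := by
  have hc1 : A 0 = A' 0 := congrArg (fun c => c.1.1) hc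
  have hc2 : H (m - 1) = H' (m - 1) := congrArg (fun c => c.1.2) hc
  have hcol : ∀ t : ℤ, 0 ≤ t → t + 1 < m →
      (if J t = t + 1 then some (H t, A (t + 1)) else none) =
        if J' t = t + 1 then some (H' t, A' (t + 1)) else none := by
    intro t h0 h1
    lift t to ℕ using h0
    exact congrFun (congrArg Prod.snd hc) ⟨t, by omega⟩
  have hJ : ∀ t : ℤ, 0 ≤ t → t + 1 < m → (J t = t + 1 ↔ J' t = t + 1) := by
    intro t h0 h1
    have := hcol t h0 h1
    split_ifs at this <;> simp_all
  have hI := le_antisymm (h'.left_le h (fun t a b => (hJ t a b).symm) hk hkm)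
    (h.left_le h' hJ hk hkm)
  have hJk := le_antisymm (h.right_le_right h' hJ hk hkm)
    (h'.right_le_right h (fun t a b => (hJ t a b).symm) hk hkm)
  have r := h.roof k hk hkm
  have hle := h.le k hk hkm
  have hge := h.ge k hk hkm
  refine ⟨hI, ?_, hJk, ?_⟩
  · have e := h.congr hk hkm le_rfl (by omega)
    have e' := h'.congr (l := I k) hk hkm hI.ge (by omega)
    rw [e.2.1, e'.2.1]
    rcases r.left_nonneg.eq_or_lt with h0 | h0
    · rw [← h0, hc1]
    · have hj := (h.right_eq_iff (k := I k - 1) (by omega) (by omega)).2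
        (by rw [sub_add_cancel]; exact e.1.symm)
      have := hcol (I k - 1) (by omega) (by omega)
      rw [if_pos hj, if_pos ((hJ _ (by omega) (by omega)).1 hj), sub_add_cancel] at this
      simpa using congrArg (fun o => o.map Prod.snd) this
  · have e := h.congr (l := J k - 1) hk hkm (by omega) (by omega)
    have e' := h'.congr (l := J k - 1) hk hkm (by omega) (by omega)
    rw [e.2.2.2, e'.2.2.2]
    rcases r.right_le.eq_or_lt with h0 | h0
    · rw [h0, hc2]
    · have hj : J (J k - 1) = J k - 1 + 1 := by rw [← e.2.2.1]; ring
      have := hcol (J k - 1) (by omega) (by omega)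
      rw [if_pos hj, if_pos ((hJ _ (by omega) (by omega)).1 hj)] at this
      simpa using congrArg (fun o => o.map Prod.fst) this

theorem subset_of_roofCode_eq (h : IsRoofChoice m n S B I A J H)
    (h' : IsRoofChoice m n S' B' I' A' J' H') (hc : roofCode m A J H = roofCode m A' J' H') :
    S ⊆ S' := by
  refine h.pair.subset_closure.trans (closure_minimal ?_ h'.pair.isClosed_lower)
  rintro ⟨x, y⟩ ⟨hx, hy, y', hyy', hmem⟩
  simp only at hx hy hyy' hmem
  have hR := h.pair.union_eq.subset (Or.inl hmem)
  have hx0 : 0 ≤ x := hR.1.1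
  have hxm : x ≤ m := hR.2.1
  have hyn : y' ≤ n := hR.2.2
  have hfl : (⌊x⌋ : ℝ) < x := lt_of_le_of_ne (Int.floor_le x) (ne_intCast_of_mem_nonIntegers hx _)
  have hfl' := Int.lt_floor_add_one x
  have hk : 0 ≤ ⌊x⌋ := Int.floor_nonneg.2 hx0
  have hkm : ⌊x⌋ < (m : ℤ) := by exact_mod_cast hfl.trans_le hxm
  obtain ⟨e1, e2, e3, e4⟩ := h.eq_of_roofCode_eq h' hc hk hkm
  have r := h.roof _ hk hkm
  have r' := h'.roof _ hk hkm
  rw [← e1, ← e2, ← e3, ← e4] at r'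
  have hi : (I ⌊x⌋ : ℝ) < x :=
    lt_of_le_of_lt (by exact_mod_cast h.le _ hk hkm) hfl
  have hj : x < J ⌊x⌋ :=
    lt_of_lt_of_le hfl' (by exact_mod_cast h.ge _ hk hkm)
  have hle : y' ≤ lineAt (I ⌊x⌋) (A ⌊x⌋) (J ⌊x⌋) (H ⌊x⌋) x := by
    by_contra! hlt
    obtain ⟨w, hw, hw'⟩ := exists_between hlt
    have hw0 := (r.lineAt_mem_Icc hi hj).1
    exact (h.pair.le_of_mem x hx w y'
      (r.mem_upper x hx hi hj w (by linarith) (by linarith) hw) hmem).not_gt hw'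
  exact r'.mem_lower x hx hi hj y hy (by linarith) (by linarith)

end IsRoofChoice

/-- The possible entries of `roofCode` at an inner column. -/
def columnCodes (n : ℕ) : Finset (Option (ℤ × ℤ)) :=
  insert none (((Finset.Icc (0 : ℤ) n).image fun a => some (a, a)) ∪
    (((Finset.Icc (1 : ℤ) n).image fun a => some (a, a - 1)) ∪
      (Finset.Icc (1 : ℤ) n).image fun a => some (a - 1, a)))

theorem card_columnCodes_le (n : ℕ) : (columnCodes n).card ≤ 3 * n + 2 := by
  have h0 : (Finset.Icc (0 : ℤ) n).card = n + 1 := by simp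
  have h1 : (Finset.Icc (1 : ℤ) n).card = n := by simp
  unfold columnCodes
  refine (Finset.card_insert_le _ _).trans ?_
  have := Finset.card_union_le ((Finset.Icc (0 : ℤ) n).image fun a => some (a, a))
    (((Finset.Icc (1 : ℤ) n).image fun a => some (a, a - 1)) ∪
      (Finset.Icc (1 : ℤ) n).image fun a => some (a - 1, a))
  have := Finset.card_union_le ((Finset.Icc (1 : ℤ) n).image fun a => some (a, a - 1))
    ((Finset.Icc (1 : ℤ) n).image fun a => some (a - 1, a))
  have := Finset.card_image_le (s := Finset.Icc (0 : ℤ) n) (f := fun a => some (a, a))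
  have := Finset.card_image_le (s := Finset.Icc (1 : ℤ) n) (f := fun a => some (a, a - 1))
  have := Finset.card_image_le (s := Finset.Icc (1 : ℤ) n) (f := fun a => some (a - 1, a))
  omega

theorem mem_columnCodes {n : ℕ} {u v : ℤ} (hu : 0 ≤ u ∧ u ≤ n) (hv : 0 ≤ v ∧ v ≤ n)
    (huv : u ≤ v + 1) (hvu : v ≤ u + 1) : some (u, v) ∈ columnCodes n := by
  simp only [columnCodes, Finset.mem_insert, Finset.mem_union, Finset.mem_image, Finset.mem_Icc,
    Option.some.injEq, Prod.mk.injEq]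
  right
  rcases lt_trichotomy u v with h | h | h
  · exact Or.inr (Or.inr ⟨v, by omega, by omega, rfl⟩)
  · exact Or.inl ⟨u, by omega, rfl, h⟩
  · exact Or.inr (Or.inl ⟨u, by omega, rfl, by omega⟩)

/-- A finite set containing the codes of all shapes. -/
def shapeCodes (m n : ℕ) : Finset ((ℤ × ℤ) × (Fin (m - 1) → Option (ℤ × ℤ))) :=
  (Finset.Icc (0 : ℤ) n ×ˢ Finset.Icc (0 : ℤ) n) ×ˢ Fintype.piFinset fun _ => columnCodes n

theorem card_shapeCodes_le (m n : ℕ) :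
    (shapeCodes m n).card ≤ (3 * n + 2) ^ (m - 1) * (n + 1) ^ 2 := by
  have h0 : (Finset.Icc (0 : ℤ) n).card = n + 1 := by simp
  rw [shapeCodes, Finset.card_product, Finset.card_product, h0, Fintype.card_piFinset_const,
    mul_comm, ← sq]
  exact Nat.mul_le_mul_right _ (Nat.pow_le_pow_left (card_columnCodes_le n) _)

theorem IsRoofChoice.roofCode_mem {m n : ℕ} {S B : Set (ℝ × ℝ)} {I A J H : ℤ → ℤ}
    (h : IsRoofChoice m n S B I A J H) (hm : 1 ≤ m) : roofCode m A J H ∈ shapeCodes m n := by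
  simp only [roofCode, shapeCodes, Finset.mem_product, Finset.mem_Icc, Fintype.mem_piFinset]
  refine ⟨⟨(h.roof 0 le_rfl (by omega)).left_height,
    (h.roof (m - 1) (by omega) (by omega)).right_height⟩, fun t => ?_⟩
  split_ifs with ht
  · have ht' := t.2
    have r := h.roof t (by omega) (by omega)
    have r' := h.roof (t + 1) (by omega) (by omega)
    have hI := (h.right_eq_iff (k := t) (by omega) (by omega)).1 ht
    have hl := lineAt_right (a := A t) (b := H t) r.lt
    have hl' := lineAt_left (I (t + 1)) (A (t + 1)) (J (t + 1)) (H (t + 1))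
    have hlt : (I t : ℝ) ≤ J t := by exact_mod_cast r.lt.le
    have hlt' : (I (t + 1) : ℝ) ≤ J (t + 1) := by exact_mod_cast r'.lt.le
    have hIJ : I (t + 1) = J t := hI.trans ht.symm
    have hk : (J t : ℝ) ∈ Set.Icc (I t : ℝ) (J t) := ⟨hlt, le_rfl⟩
    have hk' : (J t : ℝ) ∈ Set.Icc (I (t + 1) : ℝ) (J (t + 1)) := by
      rw [← hIJ]; exact ⟨le_rfl, hlt'⟩
    have hl'' : lineAt (I (t + 1)) (A (t + 1)) (J (t + 1)) (H (t + 1)) (J t) = A (t + 1) := by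
      rw [← hl', hIJ]
    exact mem_columnCodes r.right_height r'.left_height
      (h.pair.height_le_add_one r' r hk' hk hl'' r'.left_height.1 hl r.right_height.2)
      (h.pair.height_le_add_one r r' hk hk' hl r.right_height.1 hl'' r'.left_height.2)
  · exact Finset.mem_insert_self _ _

theorem IsAdmissibleSeq.subset_and_isLower {m n : ℕ} {T : ℕ → Set (Set (ℝ × ℝ))}
    (hT : IsAdmissibleSeq m n T) {i : ℕ} (hi : 1 ≤ i) (him : i ≤ 2 * m * n) :
    T i ⊆ T 1 ∧ ∀ Δ' ∈ T i, ∀ Δ ∈ T 1, LiesAbove Δ Δ' → Δ ∈ T i := by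
  induction i, hi using Nat.le_induction with
  | base => exact ⟨subset_rfl, fun _ _ _ hΔ _ => hΔ⟩
  | succ i hi ih =>
    obtain ⟨hsub, hlow⟩ := ih (by omega)
    obtain ⟨D, ⟨-, hmax⟩, he⟩ := hT.2 (i + 1) (by omega) him
    rw [Nat.add_sub_cancel] at hmax he
    rw [he]
    refine ⟨Set.sdiff_subset.trans hsub, fun Δ' hΔ' Δ hΔ hab => ⟨hlow Δ' hΔ'.1 Δ hΔ hab, ?_⟩⟩
    rintro rfl
    exact hmax Δ' hΔ'.1 hab

theorem IsAdmissibleShape.exists_roofChoice {m n : ℕ} {S : Set (ℝ × ℝ)}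
    (h : IsAdmissibleShape m n S) : ∃ B I A J H, IsRoofChoice m n S B I A J H := by
  obtain ⟨T, i, hT, hi, him, rfl⟩ := h
  obtain ⟨hsub, hlow⟩ := hT.subset_and_isLower hi him
  exact ⟨_, (hT.1.isShapePair hsub hlow).exists_roofChoice⟩

/-- The number of admissible shapes of `P_{m,n}` is at most
`(3n+2)^{m-1} (n+1)²`. -/
theorem num_admissible_shapes_le (m n : ℕ) (hm : 1 ≤ m) (hn : 1 ≤ n) :
    {S : Set (ℝ × ℝ) | IsAdmissibleShape m n S}.Finite ∧
    {S : Set (ℝ × ℝ) | IsAdmissibleShape m n S}.ncard ≤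
      (3 * n + 2) ^ (m - 1) * (n + 1) ^ 2 := by
  choose! B I A J H h using fun (S : Set (ℝ × ℝ)) (hS : IsAdmissibleShape m n S) =>
    hS.exists_roofChoice
  have hmaps : ∀ S ∈ {S | IsAdmissibleShape m n S},
      roofCode m (A S) (J S) (H S) ∈ (shapeCodes m n : Set _) :=
    fun S hS => (h S hS).roofCode_mem hm
  have hinj : Set.InjOn (fun S => roofCode m (A S) (J S) (H S)) {S | IsAdmissibleShape m n S} :=
    fun S hS S' hS' hc => ((h S hS).subset_of_roofCode_eq (h S' hS') hc).antisymm
      ((h S' hS').subset_of_roofCode_eq (h S hS) hc.symm)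
  refine ⟨Set.Finite.of_injOn hmaps hinj (Finset.finite_toSet _), ?_⟩
  refine (Set.ncard_le_ncard_of_injOn _ hmaps hinj (Finset.finite_toSet _)).trans ?_
  rw [Set.ncard_coe_finset]
  exact card_shapeCodes_le m n
end
end
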